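/- There exists a constant c > 0 such that for all 0 < η ≤ 1/2, all α, β ∈ ℝ, and all q, r ∈ 𝕋³: ∫_{𝕋³} dp / ( |α − e(p) + iη| · |β − e(p+q) + iη| · |||p − r||| ) ≤ c η^{−7/8} |log η|³ / |||q|||. -/

import Mathlib

open MeasureTheory Filter Topology

noncomputable section

/-- The torus `𝕋³ = [-1/2, 1/2]³` realized as a box in `ℝ³`. -/
def T3 : Set (Fin 3 → ℝ) := Set.pi Set.univ fun _ => Set.Icc (-(1/2) : ℝ) (1/2)

/-- The lattice dispersion relation `e(p) = ∑_j (1 - cos(2π p_j))`. -/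
def edisp (p : Fin 3 → ℝ) : ℝ := ∑ j, (1 - Real.cos (2 * Real.pi * p j))

/-- `Θ_ε(α) = ∫_{𝕋³} dq / (α - e(q) + iε)`. -/
def ThetaEps (ε α : ℝ) : ℂ := ∫ q in T3, ((α : ℂ) - (edisp q : ℂ) + (ε : ℂ) * Complex.I)⁻¹

/-- `Θ` is the limit of `Θ_ε` as `ε → 0⁺`. -/
def IsThetaLimit (Θ : ℝ → ℂ) : Prop :=
  ∀ α : ℝ, Tendsto (fun ε => ThetaEps ε α) (𝓝[>] (0 : ℝ)) (𝓝 (Θ α))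

/-- The renormalized dispersion `ω(p) = e(p) + λ² Θ(e(p))`. -/
def omegaR (Θ : ℝ → ℂ) (lam : ℝ) (p : Fin 3 → ℝ) : ℂ :=
  (edisp p : ℂ) + (lam : ℂ) ^ 2 * Θ (edisp p)

/-- A function on `𝕋³`, i.e. a `ℤ³`-periodic function on `ℝ³`. -/
def ZPeriodic (g : (Fin 3 → ℝ) → ℂ) : Prop :=
  ∀ (p : Fin 3 → ℝ) (n : Fin 3 → ℤ), g (p + fun j => (n j : ℝ)) = g p

/-- The `C¹` norm `‖g‖_∞ + ‖∇g‖_∞`. -/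
def C1Norm (g : (Fin 3 → ℝ) → ℂ) : ℝ :=
  (⨆ p : Fin 3 → ℝ, ‖g p‖) + ⨆ p : Fin 3 → ℝ, ‖fderiv ℝ g p‖

/-- `|||α||| = min {|α|, |α-2|, |α-3|, |α-4|, |α-6|}`. -/
def anorm (a : ℝ) : ℝ := min (min (min |a| |a - 2|) (min |a - 3| |a - 4|)) |a - 6|

/-- Distance between two points of the circle `ℝ/ℤ`. -/
def cdist (x y : ℝ) : ℝ := |x - y - (round (x - y) : ℝ)|

/-- `|||q||| = η + min {dist(q, γ) : γ a critical point of e}` (torus distance);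
the critical points are exactly the points with all coordinates in `{0, 1/2}` mod `1`,
and minimizing over them coordinatewise gives the formula below. -/
def tnorm (η : ℝ) (q : Fin 3 → ℝ) : ℝ :=
  η + Real.sqrt (∑ j, (min (cdist (q j) 0) (cdist (q j) (1/2))) ^ 2)

/-- `|∇e(q)|`, the Euclidean length of the gradient of the dispersion relation. -/
def gradNorm (q : Fin 3 → ℝ) : ℝ := Real.sqrt (∑ j, (2 * Real.pi * Real.sin (2 * Real.pi * q j)) ^ 2)


/-- quarter-period van der Corput bound -/
lemma aux_quarter (R : ℝ) (hR : 16 ≤ |R|) :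
    ‖∫ x in (0:ℝ)..(1/4), Complex.exp (Complex.I * ((R * Real.cos (2 * Real.pi * x) : ℝ) : ℂ))‖
      ≤ 2 / √|R| := by
  have hRpos : 0 < |R| := by linarith
  have hR0 : R ≠ 0 := abs_pos.mp hRpos
  have hpi := Real.pi_gt_three
  set s := √|R| with hs
  have hs4 : 4 ≤ s := by
    rw [hs]; exact Real.le_sqrt_of_sq_le (by norm_num; linarith)
  have hs2 : s * s = |R| := Real.mul_self_sqrt hRpos.le
  set ε := 1 / s with hε
  have hε0 : 0 < ε := by positivity
  have hε4 : ε ≤ 1/4 := by rw [hε]; exact one_div_le_one_div_of_le (by norm_num) hs4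
  let F : ℝ → ℂ := fun x => Complex.exp (Complex.I * ((R * Real.cos (2 * Real.pi * x) : ℝ) : ℂ))
  have hFc : Continuous F := by
    simp only [F]; fun_prop
  have hFn : ∀ x, ‖F x‖ = 1 := fun x => by
    simp only [F]; rw [mul_comm]; exact Complex.norm_exp_ofReal_mul_I _
  have hsin : ∀ x ∈ Set.Icc ε (1/4), 4 * ε ≤ Real.sin (2 * Real.pi * x) := by
    intro x hx
    have h0 : 0 < x := lt_of_lt_of_le hε0 hx.1
    have := @Real.mul_le_sin (2 * Real.pi * x) (by positivity)
      (by nlinarith [hx.2])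
    have h2 : 2 / Real.pi * (2 * Real.pi * x) = 4 * x := by field_simp; ring
    rw [h2] at this
    linarith [hx.1]
  -- real antiderivative factor
  let g : ℝ → ℝ := fun x => 1 / (2 * Real.pi * R * Real.sin (2 * Real.pi * x))
  let g' : ℝ → ℝ := fun x => - (Real.cos (2 * Real.pi * x)) / (R * Real.sin (2 * Real.pi * x) ^ 2)
  have hg : ∀ x ∈ Set.Icc ε (1/4), HasDerivAt g (g' x) x := by
    intro x hx
    have hsx : Real.sin (2 * Real.pi * x) ≠ 0 := by have := hsin x hx; nlinarith
    have h1 : HasDerivAt (fun x : ℝ => 2 * Real.pi * x) (2 * Real.pi) x := by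
      simpa using (hasDerivAt_id x).const_mul (2 * Real.pi)
    have h2 := (h1.sin.const_mul (2 * Real.pi * R)).inv (by positivity)
    have h3 := h2.congr_deriv (g' := g' x) (by simp only [g']; field_simp)
    have h4 : g = (fun x : ℝ => (2 * Real.pi * R * Real.sin (2 * Real.pi * x)))⁻¹ := by
      funext y; simp [g]
    rw [h4]; exact h3
  have hgc : ContinuousOn g' (Set.Icc ε (1/4)) := by
    apply ContinuousOn.div
    · fun_prop
    · fun_prop
    · intro x hx
      have := hsin x hx
      have h3 : 0 < Real.sin (2 * Real.pi * x) := by linarith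
      positivity
  have huIcc : Set.uIcc ε (1/4) = Set.Icc ε (1/4) := Set.uIcc_of_le hε4
  have hF' : ∀ x, HasDerivAt F (-(Complex.I * ((2 * Real.pi * R * Real.sin (2 * Real.pi * x) : ℝ):ℂ)) * F x) x := by
    intro x
    have h1 : HasDerivAt (fun x : ℝ => 2 * Real.pi * x) (2 * Real.pi) x := by
      simpa using (hasDerivAt_id x).const_mul (2 * Real.pi)
    have h2 := ((h1.cos.const_mul R).ofReal_comp.const_mul Complex.I).cexp
    simp only [F]
    convert h2 using 1
    push_cast; ring
  have hgi : IntervalIntegrable g' volume ε (1/4) :=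
    ContinuousOn.intervalIntegrable (by rw [huIcc]; exact hgc)
  have hparts := intervalIntegral.integral_mul_deriv_eq_deriv_mul (a := ε) (b := 1/4)
    (u := fun x => Complex.I * (g x : ℂ)) (v := F)
    (u' := fun x => Complex.I * (g' x : ℂ))
    (v' := fun x => -(Complex.I * ((2 * Real.pi * R * Real.sin (2 * Real.pi * x) : ℝ):ℂ)) * F x)
    (by intro x hx; rw [huIcc] at hx; exact ((hg x hx).ofReal_comp).const_mul _)
    (fun x _ => hF' x)
    (by
      apply ContinuousOn.intervalIntegrable; rw [huIcc]
      exact continuousOn_const.mul (Complex.continuous_ofReal.comp_continuousOn hgc))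
    (by
      apply Continuous.intervalIntegrable
      fun_prop)
  have hcongr : ∫ x in ε..(1/4), (Complex.I * (g x : ℂ)) * (-(Complex.I * ((2 * Real.pi * R * Real.sin (2 * Real.pi * x) : ℝ):ℂ)) * F x) = ∫ x in ε..(1/4), F x := by
    apply intervalIntegral.integral_congr
    intro x hx
    rw [huIcc] at hx
    have hsx : Real.sin (2 * Real.pi * x) ≠ 0 := by have := hsin x hx; nlinarith
    have : g x * (2 * Real.pi * R * Real.sin (2 * Real.pi * x)) = 1 := by
      simp only [g]; field_simp
    have h2 : (g x : ℂ) * ((2 * Real.pi * R * Real.sin (2 * Real.pi * x) : ℝ):ℂ) = 1 := by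
      rw [← Complex.ofReal_mul, this]; simp
    show (Complex.I * (g x : ℂ)) * (-(Complex.I * ((2 * Real.pi * R * Real.sin (2 * Real.pi * x) : ℝ):ℂ)) * F x) = F x
    calc _ = -(Complex.I * Complex.I) * ((g x : ℂ) * ((2 * Real.pi * R * Real.sin (2 * Real.pi * x) : ℝ):ℂ)) * F x := by ring
      _ = F x := by rw [h2, Complex.I_mul_I]; ring
  rw [hcongr] at hparts
  -- bounds
  have hgabs : ∀ x ∈ Set.Icc ε (1/4), |g x| ≤ 1 / (8 * Real.pi * |R| * ε) := by
    intro x hx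
    have := hsin x hx
    have h3 : 0 < Real.sin (2 * Real.pi * x) := by linarith
    simp only [g]
    rw [abs_div, abs_one, abs_mul, abs_mul, abs_of_pos (by positivity : 0 < 2 * Real.pi), abs_of_pos h3]
    apply one_div_le_one_div_of_le (by positivity)
    have : 0 < 2 * Real.pi * |R| := by positivity
    nlinarith
  have hg'abs : ∫ x in ε..(1/4), |g' x| ≤ 2 / (8 * Real.pi * |R| * ε) := by
    have h1 : ∀ x ∈ Set.Icc ε (1/4), |g' x| = -(SignType.sign R : ℝ) * g' x := by
      intro x hx
      have hc : 0 ≤ Real.cos (2 * Real.pi * x) := by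
        apply Real.cos_nonneg_of_neg_pi_div_two_le_of_le
        · have := hx.1; nlinarith
        · nlinarith [hx.2]
      have h3 : 0 < Real.sin (2 * Real.pi * x) := by have := hsin x hx; linarith
      simp only [g']
      rcases lt_or_gt_of_ne hR0 with h | h
      · rw [sign_neg h, abs_of_nonneg]
        · simp
        · apply div_nonneg_of_nonpos (by linarith)
          exact mul_nonpos_of_nonpos_of_nonneg h.le (by positivity)
      · rw [sign_pos h, abs_of_nonpos]
        · simp
        · apply div_nonpos_of_nonpos_of_nonneg (by linarith)
          positivity
    have h2 : ∫ x in ε..(1/4), |g' x| = ∫ x in ε..(1/4), -(SignType.sign R : ℝ) * g' x := by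
      apply intervalIntegral.integral_congr
      intro x hx; rw [huIcc] at hx; exact h1 x hx
    rw [h2, intervalIntegral.integral_const_mul,
      intervalIntegral.integral_eq_sub_of_hasDerivAt (f := g) (by rw [huIcc]; exact hg) hgi]
    have e1 := hgabs ε ⟨le_rfl, hε4⟩
    have e2 := hgabs (1/4) ⟨hε4, le_rfl⟩
    have hsg : |(-(SignType.sign R : ℝ))| ≤ 1 := by
      rcases lt_or_gt_of_ne hR0 with h | h
      · simp [sign_neg h]
      · simp [sign_pos h]
    calc _ ≤ |(-(SignType.sign R : ℝ)) * (g (1/4) - g ε)| := le_abs_self _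
      _ = |(-(SignType.sign R : ℝ))| * |g (1/4) - g ε| := abs_mul _ _
      _ ≤ 1 * (|g (1/4)| + |g ε|) := by
          gcongr; exact abs_sub _ _
      _ ≤ 2 / (8 * Real.pi * |R| * ε) := by
          rw [show (2:ℝ) / (8 * Real.pi * |R| * ε) = 1 / (8 * Real.pi * |R| * ε) + 1 / (8 * Real.pi * |R| * ε) by ring]
          linarith
  have hmain : ‖∫ x in ε..(1/4), F x‖ ≤ 4 / (8 * Real.pi * |R| * ε) := by
    rw [hparts]
    have n1 : ‖∫ x in ε..(1/4), (Complex.I * (g' x : ℂ)) * F x‖ ≤ ∫ x in ε..(1/4), |g' x| := by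
      refine (intervalIntegral.norm_integral_le_integral_norm hε4).trans (le_of_eq ?_)
      apply intervalIntegral.integral_congr
      intro x _
      simp [hFn]
    have e1 := hgabs ε ⟨le_rfl, hε4⟩
    have e2 := hgabs (1/4) ⟨hε4, le_rfl⟩
    have n2 : ‖Complex.I * (g (1/4) : ℂ) * F (1/4)‖ = |g (1/4)| := by simp [hFn]
    have n3 : ‖Complex.I * (g ε : ℂ) * F ε‖ = |g ε| := by simp [hFn]
    have := norm_sub_le (Complex.I * (g (1/4) : ℂ) * F (1/4) - Complex.I * (g ε : ℂ) * F ε) (∫ x in ε..(1/4), (Complex.I * (g' x : ℂ)) * F x)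
    have h4 := norm_sub_le (Complex.I * (g (1/4) : ℂ) * F (1/4)) (Complex.I * (g ε : ℂ) * F ε)
    have e4 : (4:ℝ) / (8 * Real.pi * |R| * ε) = 1 / (8 * Real.pi * |R| * ε) + 1 / (8 * Real.pi * |R| * ε) + 2 / (8 * Real.pi * |R| * ε) := by ring
    rw [e4]
    linarith
  have hsmall : ‖∫ x in (0:ℝ)..ε, F x‖ ≤ ε := by
    have := intervalIntegral.norm_integral_le_of_norm_le_const (a := 0) (b := ε) (f := F) (C := 1) (fun x _ => (hFn x).le)
    simpa [abs_of_pos hε0] using this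
  have hsplit : ∫ x in (0:ℝ)..(1/4), F x = (∫ x in (0:ℝ)..ε, F x) + ∫ x in ε..(1/4), F x :=
    (intervalIntegral.integral_add_adjacent_intervals (hFc.intervalIntegrable _ _) (hFc.intervalIntegrable _ _)).symm
  show ‖∫ x in (0:ℝ)..(1/4), F x‖ ≤ 2 / s
  rw [hsplit]
  refine (norm_add_le _ _).trans ?_
  have hs0 : 0 < s := by linarith
  have : 4 / (8 * Real.pi * |R| * ε) ≤ 1 / s := by
    rw [← hs2, hε]
    rw [div_le_div_iff₀ (by positivity) (by positivity)]
    have : 8 * Real.pi * (s * s) * (1 / s) = 8 * Real.pi * s := by field_simp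
    rw [this]; nlinarith
  have : 2 / s = ε + 1 / s := by rw [hε]; ring
  linarith

lemma aux_bessel_interval (R : ℝ) (hR : R ≠ 0) :
    ‖∫ x in (-(1/2):ℝ)..(1/2), Complex.exp (Complex.I * ((R * Real.cos (2 * Real.pi * x) : ℝ) : ℂ))‖
      ≤ 8 / √|R| := by
  have hRpos : 0 < |R| := abs_pos.mpr hR
  let F : ℝ → ℝ → ℂ := fun R x => Complex.exp (Complex.I * ((R * Real.cos (2 * Real.pi * x) : ℝ) : ℂ))
  have hFc : ∀ R, Continuous (F R) := by intro R; simp only [F]; fun_prop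
  have hFn : ∀ R x, ‖F R x‖ = 1 := fun R x => by
    simp only [F]; rw [mul_comm]; exact Complex.norm_exp_ofReal_mul_I _
  show ‖∫ x in (-(1/2):ℝ)..(1/2), F R x‖ ≤ 8 / √|R|
  rcases lt_or_ge |R| 16 with h | h
  · have := intervalIntegral.norm_integral_le_of_norm_le_const (a := -(1/2)) (b := 1/2) (f := F R) (C := 1) (fun x _ => (hFn R x).le)
    have h2 : √|R| ≤ 4 := by
      rw [Real.sqrt_le_left (by norm_num)]; norm_num; linarith
    have h3 : 1 ≤ 8 / √|R| := by
      rw [le_div_iff₀ (Real.sqrt_pos.mpr hRpos)]; linarith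
    norm_num at this
    norm_num
    linarith
  · have h1 := aux_quarter R h
    have h2 := aux_quarter (-R) (by rwa [abs_neg])
    rw [abs_neg] at h2
    have e1 : ∫ x in (1/4:ℝ)..(1/2), F R x = ∫ x in (0:ℝ)..(1/4), F (-R) x := by
      have := intervalIntegral.integral_comp_sub_left (a := 0) (b := 1/4) (F R) (1/2)
      rw [show (1/2:ℝ) - 1/4 = 1/4 by norm_num, sub_zero] at this
      rw [← this]
      congr 1; ext x
      simp only [F]
      rw [show 2 * Real.pi * (1/2 - x) = Real.pi - 2 * Real.pi * x by ring, Real.cos_pi_sub]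
      congr 2; push_cast; ring
    have e2 : ∫ x in (-(1/2):ℝ)..0, F R x = ∫ x in (0:ℝ)..(1/2), F R x := by
      have := intervalIntegral.integral_comp_neg (a := 0) (b := 1/2) (F R)
      rw [neg_zero] at this
      rw [← this]
      congr 1; ext x
      simp only [F]
      rw [show 2 * Real.pi * (-x) = -(2 * Real.pi * x) by ring, Real.cos_neg]
    have e3 : ∫ x in (0:ℝ)..(1/2), F R x = (∫ x in (0:ℝ)..(1/4), F R x) + ∫ x in (1/4:ℝ)..(1/2), F R x :=
      (intervalIntegral.integral_add_adjacent_intervals ((hFc R).intervalIntegrable _ _) ((hFc R).intervalIntegrable _ _)).symm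
    have e4 : ∫ x in (-(1/2):ℝ)..(1/2), F R x = (∫ x in (-(1/2):ℝ)..0, F R x) + ∫ x in (0:ℝ)..(1/2), F R x :=
      (intervalIntegral.integral_add_adjacent_intervals ((hFc R).intervalIntegrable _ _) ((hFc R).intervalIntegrable _ _)).symm
    have n : ‖∫ x in (0:ℝ)..(1/2), F R x‖ ≤ 4 / √|R| := by
      rw [e3, e1]
      refine (norm_add_le _ _).trans ?_
      have : 4 / √|R| = 2 / √|R| + 2 / √|R| := by ring
      rw [this]
      exact add_le_add h1 h2
    rw [e4, e2]
    refine (norm_add_le _ _).trans ?_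
    have : 8 / √|R| = 4 / √|R| + 4 / √|R| := by ring
    linarith

lemma aux_poisson (c t : ℝ) (hc : 0 < c) :
    ∫ ξ in Set.Ioi (0:ℝ), Real.exp (-c * ξ) * Real.cos (ξ * t) = c / (c ^ 2 + t ^ 2) := by
  have ha : ((-c : ℂ) + Complex.I * t).re < 0 := by simp [hc]
  have h1 := integral_exp_mul_complex_Ioi ha 0
  have h2 := integrableOn_exp_mul_complex_Ioi ha 0
  have h3 : ∀ ξ : ℝ, Real.exp (-c * ξ) * Real.cos (ξ * t) =
      RCLike.re (Complex.exp (((-c : ℂ) + Complex.I * t) * ξ)) := by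
    intro ξ
    rw [RCLike.re_to_complex, Complex.exp_re]
    simp [mul_comm]
  simp_rw [h3]
  rw [integral_re h2, h1]
  simp only [Complex.ofReal_zero, mul_zero, Complex.exp_zero, RCLike.re_to_complex]
  rw [Complex.div_re]
  simp [Complex.normSq_apply]
  field_simp

lemma aux_gamma_integrable (s η : ℝ) (hs : s < 1) (hη : 0 < η) :
    IntegrableOn (fun ξ : ℝ => ξ ^ (-s) * Real.exp (-η * ξ)) (Set.Ioi 0) := by
  have := integrableOn_rpow_mul_exp_neg_mul_rpow (p := 1) (s := -s) (b := η) (by linarith) one_pos hη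
  simpa using this

lemma aux_weight_integrable (s η : ℝ) (hs : s < 1) (hη : 0 < η) :
    Integrable (fun ξ : ℝ => |ξ| ^ (-s) * Real.exp (-η * |ξ|)) := by
  have h := aux_gamma_integrable s η hs hη
  have h2 : IntegrableOn (fun ξ : ℝ => |ξ| ^ (-s) * Real.exp (-η * |ξ|)) (Set.Ioi 0) := by
    refine h.congr_fun ?_ measurableSet_Ioi
    intro x hx
    simp only [abs_of_pos (Set.mem_Ioi.1 hx)]
  have h3 : IntegrableOn (fun ξ : ℝ => |ξ| ^ (-s) * Real.exp (-η * |ξ|)) (Set.Iic 0) := by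
    rw [integrableOn_Iic_iff_integrableOn_Iio]
    have := ((Measure.measurePreserving_neg (volume : Measure ℝ)).integrableOn_comp_preimage
      (Homeomorph.neg ℝ).measurableEmbedding (s := Set.Ioi 0)
      (f := fun ξ : ℝ => |ξ| ^ (-s) * Real.exp (-η * |ξ|))).2 h2
    simpa [Function.comp_def] using this
  rw [← integrableOn_univ, ← Set.Iic_union_Ioi (a := (0:ℝ))]
  exact h3.union h2

lemma aux_weight_integral (s η : ℝ) (hs : s < 1) (hη : 0 < η) :
    ∫ ξ : ℝ, |ξ| ^ (-s) * Real.exp (-η * |ξ|) = 2 * Real.Gamma (1 - s) * η ^ (-(1 - s)) := by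
  rw [integral_comp_abs (f := fun ξ : ℝ => ξ ^ (-s) * Real.exp (-η * ξ))]
  have := Real.integral_rpow_mul_exp_neg_mul_Ioi (a := 1 - s) (r := η) (by linarith) hη
  rw [show 1 - s - 1 = -s by ring] at this
  simp_rw [neg_mul]
  rw [this, one_div, Real.inv_rpow hη.le, Real.rpow_neg hη.le]
  ring

lemma aux_kernel_lower (s : ℝ) (hs0 : 0 < s) (hs1 : s < 1) :
    ∃ c : ℝ, 0 < c ∧ ∀ η t : ℝ, 0 < η →
      c * (√(t ^ 2 + η ^ 2)) ^ (s - 1) ≤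
        2 * ∫ ξ in Set.Ioi (0:ℝ), ξ ^ (-s) * Real.exp (-η * ξ) * Real.cos (ξ * t) := by
  have hΓ : 0 < Real.Gamma s := Real.Gamma_pos_of_pos hs0
  refine ⟨2 * (2 ^ (s - 1) / 10) / Real.Gamma s, by positivity, ?_⟩
  intro η t hη
  set M := √(t ^ 2 + η ^ 2) with hM
  have hM0 : 0 < M := Real.sqrt_pos.mpr (by positivity)
  have hM2 : M ^ 2 = t ^ 2 + η ^ 2 := Real.sq_sqrt (by positivity)
  let f : ℝ → ℝ → ℝ := fun ξ h => h ^ (s - 1) * Real.exp (-(h + η) * ξ) * Real.cos (ξ * t)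
  -- inner integral in h
  have hin : ∀ ξ ∈ Set.Ioi (0:ℝ), ∫ h in Set.Ioi (0:ℝ), h ^ (s - 1) * Real.exp (-(h + η) * ξ)
      = Real.Gamma s * (ξ ^ (-s) * Real.exp (-η * ξ)) := by
    intro ξ hξ
    have h1 := Real.integral_rpow_mul_exp_neg_mul_Ioi (a := s) (r := ξ) hs0 hξ
    have h2 : ∀ h : ℝ, h ^ (s - 1) * Real.exp (-(h + η) * ξ) =
        Real.exp (-η * ξ) * (h ^ (s - 1) * Real.exp (-(ξ * h))) := by
      intro h
      rw [show -(h + η) * ξ = -η * ξ + -(ξ * h) by ring, Real.exp_add]; ring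
    simp_rw [h2]
    rw [integral_const_mul, h1, one_div, Real.inv_rpow (le_of_lt hξ), Real.rpow_neg (le_of_lt hξ)]
    ring
  have hmeas : AEStronglyMeasurable (fun z : ℝ × ℝ => z.2 ^ (s - 1) * Real.exp (-(z.2 + η) * z.1))
      ((volume.restrict (Set.Ioi (0:ℝ))).prod (volume.restrict (Set.Ioi (0:ℝ)))) := by
    apply Measurable.aestronglyMeasurable
    fun_prop
  have hfint0 : Integrable (fun z : ℝ × ℝ => z.2 ^ (s - 1) * Real.exp (-(z.2 + η) * z.1))
      ((volume.restrict (Set.Ioi (0:ℝ))).prod (volume.restrict (Set.Ioi (0:ℝ)))) := by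
    rw [integrable_prod_iff hmeas]
    constructor
    · filter_upwards [ae_restrict_mem measurableSet_Ioi] with ξ hξ
      have hξ' : 0 < ξ := hξ
      have := (aux_gamma_integrable (1 - s) ξ (by linarith) hξ').const_mul (Real.exp (-η * ξ))
      refine this.congr ?_
      filter_upwards with h
      rw [show -(h + η) * ξ = -η * ξ + -ξ * h by ring, Real.exp_add, show -(1 - s) = s - 1 by ring]; ring
    · have := (aux_gamma_integrable s η hs1 hη).const_mul (Real.Gamma s)
      refine this.congr ?_
      filter_upwards [ae_restrict_mem measurableSet_Ioi] with ξ hξ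
      rw [← hin ξ hξ]
      apply setIntegral_congr_fun measurableSet_Ioi
      intro h hh
      have : 0 < h := hh
      simp only
      rw [Real.norm_of_nonneg (by positivity)]
  have hfint : Integrable (Function.uncurry f)
      ((volume.restrict (Set.Ioi (0:ℝ))).prod (volume.restrict (Set.Ioi (0:ℝ)))) := by
    refine hfint0.mono (by apply Measurable.aestronglyMeasurable; simp only [f, Function.uncurry_def]; fun_prop) ?_
    filter_upwards with z
    simp only [f, Function.uncurry_def]
    rw [norm_mul]
    exact mul_le_of_le_one_right (norm_nonneg _) (Real.abs_cos_le_one _)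
  have hswap := integral_integral_swap hfint
  have hL : ∫ ξ in Set.Ioi (0:ℝ), ∫ h in Set.Ioi (0:ℝ), f ξ h =
      Real.Gamma s * ∫ ξ in Set.Ioi (0:ℝ), ξ ^ (-s) * Real.exp (-η * ξ) * Real.cos (ξ * t) := by
    rw [← integral_const_mul]
    apply setIntegral_congr_fun measurableSet_Ioi
    intro ξ hξ
    simp only [f]
    rw [integral_mul_const, hin ξ hξ]; ring
  have hRr : ∀ h ∈ Set.Ioi (0:ℝ), ∫ ξ in Set.Ioi (0:ℝ), f ξ h =
      h ^ (s - 1) * ((h + η) / ((h + η) ^ 2 + t ^ 2)) := by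
    intro h hh
    have hh' : 0 < h := hh
    rw [← aux_poisson (h + η) t (by positivity), ← integral_const_mul]
    simp only [f, mul_assoc]
  have hRint : IntegrableOn (fun h => h ^ (s - 1) * ((h + η) / ((h + η) ^ 2 + t ^ 2))) (Set.Ioi 0) := by
    have := hfint.integral_prod_right
    refine Integrable.congr this ?_
    filter_upwards [ae_restrict_mem measurableSet_Ioi] with h hh
    exact hRr h hh
  have hlow : (2 ^ (s - 1) / 10) * M ^ (s - 1) ≤
      ∫ h in Set.Ioi (0:ℝ), h ^ (s - 1) * ((h + η) / ((h + η) ^ 2 + t ^ 2)) := by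
    have hsub : Set.Icc M (2 * M) ⊆ Set.Ioi 0 := fun x hx => lt_of_lt_of_le hM0 hx.1
    have h1 := setIntegral_mono_set (s := Set.Icc M (2 * M)) hRint
      (by
        filter_upwards [ae_restrict_mem measurableSet_Ioi] with h hh
        have : 0 < h := hh
        simp only [Pi.zero_apply]; positivity) hsub.eventuallyLE
    refine le_trans ?_ h1
    have h2 : ∫ h in Set.Icc M (2 * M), (2 * M) ^ (s - 1) * (1 / (10 * M)) ≤
        ∫ h in Set.Icc M (2 * M), h ^ (s - 1) * ((h + η) / ((h + η) ^ 2 + t ^ 2)) := by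
      apply setIntegral_mono_on _ (hRint.mono_set hsub) measurableSet_Icc
      · intro h hh
        have hh0 : 0 < h := lt_of_lt_of_le hM0 hh.1
        have hηM : η ≤ M := by nlinarith [sq_nonneg t]
        apply mul_le_mul
        · exact Real.rpow_le_rpow_of_nonpos hh0 hh.2 (by linarith)
        · rw [div_le_div_iff₀ (by positivity) (by positivity)]
          have := hh.1
          have := hh.2
          nlinarith [sq_nonneg η]
        · positivity
        · positivity
      · exact integrableOn_const (by simp)
    refine le_trans (le_of_eq ?_) h2
    rw [setIntegral_const]
    simp only [Measure.real, Real.volume_Icc, smul_eq_mul]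
    rw [ENNReal.toReal_ofReal (by linarith), Real.mul_rpow (by norm_num) hM0.le]
    field_simp
    ring
  have : Real.Gamma s * ∫ ξ in Set.Ioi (0:ℝ), ξ ^ (-s) * Real.exp (-η * ξ) * Real.cos (ξ * t)
      = ∫ h in Set.Ioi (0:ℝ), h ^ (s - 1) * ((h + η) / ((h + η) ^ 2 + t ^ 2)) := by
    rw [← hL, hswap]
    exact setIntegral_congr_fun measurableSet_Ioi hRr
  rw [← this] at hlow
  calc 2 * (2 ^ (s - 1) / 10) / Real.Gamma s * M ^ (s - 1) = 2 * ((2 ^ (s - 1) / 10) * M ^ (s - 1)) / Real.Gamma s := by ring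
    _ ≤ _ := by
      rw [div_le_iff₀ hΓ]; linarith

lemma aux_kernel_eq (s : ℝ) (hs1 : s < 1) (η t : ℝ) (hη : 0 < η) :
    ∫ ξ : ℝ, ((|ξ| ^ (-s) * Real.exp (-η * |ξ|) : ℝ) : ℂ) * Complex.exp (Complex.I * ((ξ * t : ℝ) : ℂ))
      = ((2 * ∫ ξ in Set.Ioi (0:ℝ), ξ ^ (-s) * Real.exp (-η * ξ) * Real.cos (ξ * t) : ℝ) : ℂ) := by
  set F : ℝ → ℂ := fun ξ => ((|ξ| ^ (-s) * Real.exp (-η * |ξ|) : ℝ) : ℂ) * Complex.exp (Complex.I * ((ξ * t : ℝ) : ℂ)) with hF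
  have hFi : Integrable F := by
    have h := (aux_weight_integrable s η hs1 hη).ofReal (𝕜 := ℂ)
    refine h.mono (by apply Measurable.aestronglyMeasurable; fun_prop) ?_
    filter_upwards with ξ
    simp only [hF]
    rw [norm_mul, mul_comm Complex.I, Complex.norm_exp_ofReal_mul_I, mul_one]
    rfl
  have h1 := (integral_add_compl (measurableSet_Iic (a := (0:ℝ))) hFi).symm
  rw [Set.compl_Iic] at h1
  have h2 : ∫ ξ in Set.Iic (0:ℝ), F ξ = ∫ ξ in Set.Ioi (0:ℝ), F (-ξ) := by
    have := integral_comp_neg_Iic 0 (fun x => F (-x))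
    simpa using this
  rw [h1, h2, ← integral_add _ hFi.integrableOn]
  · rw [← integral_const_mul, ← integral_complex_ofReal]
    apply setIntegral_congr_fun measurableSet_Ioi
    intro ξ hξ
    have hξ' : 0 < ξ := hξ
    simp only [hF, abs_neg, abs_of_pos hξ']
    have : Complex.exp (Complex.I * ((-ξ * t : ℝ) : ℂ)) + Complex.exp (Complex.I * ((ξ * t : ℝ) : ℂ)) = 2 * (Real.cos (ξ * t) : ℂ) := by
      rw [Complex.ofReal_cos, Complex.two_cos, add_comm]
      congr 2 <;> push_cast <;> ring
    rw [← mul_add, this]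
    simp; ring
  · exact (hFi.comp_neg).integrableOn

/-- the one-dimensional oscillatory integral -/
noncomputable def pj (ξ1 ξ2 q : ℝ) : ℂ :=
  ∫ x in Set.Icc (-(1/2):ℝ) (1/2), Complex.exp (Complex.I *
    ((ξ1 * Real.cos (2 * Real.pi * x) + ξ2 * Real.cos (2 * Real.pi * (x + q)) : ℝ) : ℂ))

lemma pj_le_one (ξ1 ξ2 q : ℝ) : ‖pj ξ1 ξ2 q‖ ≤ 1 := by
  unfold pj
  have := norm_setIntegral_le_of_norm_le_const (μ := volume) (s := Set.Icc (-(1/2):ℝ) (1/2)) (C := 1)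
    (f := fun x : ℝ => Complex.exp (Complex.I *
    ((ξ1 * Real.cos (2 * Real.pi * x) + ξ2 * Real.cos (2 * Real.pi * (x + q)) : ℝ) : ℂ)))
    (by simp) (by intro x _; rw [mul_comm, Complex.norm_exp_ofReal_mul_I])
  refine this.trans ?_
  simp [Measure.real]
  norm_num

/-- amplitude -/
noncomputable def pR (ξ1 ξ2 q : ℝ) : ℝ :=
  ‖(ξ1 : ℂ) + ξ2 * Complex.exp (((2 * Real.pi * q : ℝ) : ℂ) * Complex.I)‖

lemma pR_sq (ξ1 ξ2 q : ℝ) :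
    pR ξ1 ξ2 q ^ 2 = ξ1 ^ 2 + ξ2 ^ 2 + 2 * ξ1 * ξ2 * Real.cos (2 * Real.pi * q) := by
  unfold pR
  generalize 2 * Real.pi * q = θ
  rw [← Complex.normSq_eq_norm_sq, Complex.normSq_apply, Complex.exp_mul_I,
    ← Complex.ofReal_cos, ← Complex.ofReal_sin]
  simp [-Complex.ofReal_cos, -Complex.ofReal_sin]
  linear_combination ξ2 ^ 2 * Real.sin_sq_add_cos_sq θ

lemma pR_nonneg (ξ1 ξ2 q : ℝ) : 0 ≤ pR ξ1 ξ2 q := norm_nonneg _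

lemma pj_le (ξ1 ξ2 q : ℝ) (h : pR ξ1 ξ2 q ≠ 0) : ‖pj ξ1 ξ2 q‖ ≤ 8 / √(pR ξ1 ξ2 q) := by
  set z : ℂ := (ξ1 : ℂ) + ξ2 * Complex.exp (((2 * Real.pi * q : ℝ) : ℂ) * Complex.I) with hz
  have hRz : pR ξ1 ξ2 q = ‖z‖ := rfl
  set c := z.arg / (2 * Real.pi) with hc
  have hpi := Real.pi_pos
  have hre : z.re = ξ1 + ξ2 * Real.cos (2 * Real.pi * q) := by
    rw [hz]; generalize 2 * Real.pi * q = θ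
    rw [Complex.exp_mul_I, ← Complex.ofReal_cos, ← Complex.ofReal_sin]; simp [-Complex.ofReal_cos, -Complex.ofReal_sin]
  have him : z.im = ξ2 * Real.sin (2 * Real.pi * q) := by
    rw [hz]; generalize 2 * Real.pi * q = θ
    rw [Complex.exp_mul_I, ← Complex.ofReal_cos, ← Complex.ofReal_sin]; simp [-Complex.ofReal_cos, -Complex.ofReal_sin]
  have hph : ∀ x : ℝ, ξ1 * Real.cos (2 * Real.pi * x) + ξ2 * Real.cos (2 * Real.pi * (x + q)) =
      ‖z‖ * Real.cos (2 * Real.pi * (x + c)) := by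
    intro x
    have e : 2 * Real.pi * (x + c) = 2 * Real.pi * x + z.arg := by rw [hc]; field_simp
    rw [e, Real.cos_add, show 2 * Real.pi * (x + q) = 2 * Real.pi * x + 2 * Real.pi * q by ring, Real.cos_add]
    have h1 := Complex.norm_mul_cos_arg z
    have h2 := Complex.norm_mul_sin_arg z
    rw [hre] at h1; rw [him] at h2
    linear_combination (-Real.cos (2 * Real.pi * x)) * h1 + Real.sin (2 * Real.pi * x) * h2
  let F : ℝ → ℂ := fun x => Complex.exp (Complex.I * ((‖z‖ * Real.cos (2 * Real.pi * x) : ℝ) : ℂ))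
  have hper : Function.Periodic F 1 := by
    intro x
    simp only [F]
    rw [show 2 * Real.pi * (x + 1) = 2 * Real.pi * x + 2 * Real.pi by ring, Real.cos_add_two_pi]
  have h0 := aux_bessel_interval ‖z‖ (by rwa [← hRz])
  rw [abs_of_nonneg (norm_nonneg z)] at h0
  rw [hRz]
  refine le_trans (le_of_eq ?_) h0
  congr 1
  unfold pj
  rw [integral_Icc_eq_integral_Ioc, ← intervalIntegral.integral_of_le (by norm_num)]
  simp_rw [hph]
  show ∫ x in (-(1/2):ℝ)..(1/2), F (x + c) = ∫ x in (-(1/2):ℝ)..(1/2), F x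
  rw [intervalIntegral.integral_comp_add_right]
  have := hper.intervalIntegral_add_eq (-(1/2) + c) (-(1/2))
  rw [show -(1/2) + c + 1 = 1/2 + c by ring, show (-(1/2):ℝ) + 1 = 1/2 by norm_num] at this
  exact this

lemma pj_sq_le (ξ1 ξ2 q : ℝ) : ‖pj ξ1 ξ2 q‖ ^ 2 ≤ 65 / (1 + |(|ξ1| - |ξ2|)|) := by
  have h1 := pj_le_one ξ1 ξ2 q
  set τ := |(|ξ1| - |ξ2|)| with hτ
  have hτ0 : 0 ≤ τ := abs_nonneg _
  rw [le_div_iff₀ (by positivity)]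
  have hn := norm_nonneg (pj ξ1 ξ2 q)
  have hR : τ ≤ pR ξ1 ξ2 q := by
    rw [hτ]
    apply abs_le_of_sq_le_sq _ (pR_nonneg _ _ _)
    rw [pR_sq]
    have := Real.abs_cos_le_one (2 * Real.pi * q)
    have h3 : |ξ1 * ξ2 * Real.cos (2 * Real.pi * q)| ≤ |ξ1| * |ξ2| := by
      rw [abs_mul, abs_mul]; exact mul_le_of_le_one_right (by positivity) this
    have := (abs_le.1 h3).1
    nlinarith [sq_abs ξ1, sq_abs ξ2]
  have h2 : ‖pj ξ1 ξ2 q‖ ^ 2 * τ ≤ 64 := by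
    rcases eq_or_lt_of_le hτ0 with h | h
    · rw [← h]; norm_num
    · have hRp := lt_of_lt_of_le h hR
      have := pj_le ξ1 ξ2 q hRp.ne'
      have h4 : ‖pj ξ1 ξ2 q‖ ^ 2 ≤ 64 / pR ξ1 ξ2 q := by
        calc _ ≤ (8 / √(pR ξ1 ξ2 q)) ^ 2 := by gcongr
          _ = _ := by rw [div_pow, Real.sq_sqrt hRp.le]; norm_num
      rw [le_div_iff₀ hRp] at h4
      nlinarith [sq_nonneg ‖pj ξ1 ξ2 q‖]
  nlinarith

lemma pj_le_rpow (ξ1 ξ2 q : ℝ) (hq : Real.sin (2 * Real.pi * q) ≠ 0) (h1 : ξ1 ≠ 0) (h2 : ξ2 ≠ 0) :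
    ‖pj ξ1 ξ2 q‖ ≤ 8 * |Real.sin (2 * Real.pi * q)| ^ (-(1/2):ℝ) *
      (|ξ1| ^ (-(1/4):ℝ) * |ξ2| ^ (-(1/4):ℝ)) := by
  set S := |Real.sin (2 * Real.pi * q)| with hS
  have hS0 : 0 < S := abs_pos.2 hq
  have a1 : 0 < |ξ1| := abs_pos.2 h1
  have a2 : 0 < |ξ2| := abs_pos.2 h2
  have hsq : S ^ 2 * (|ξ1| * |ξ2|) ≤ pR ξ1 ξ2 q ^ 2 := by
    rw [pR_sq]
    set C := Real.cos (2 * Real.pi * q) with hC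
    have hSC : S ^ 2 = 1 - C ^ 2 := by
      rw [hS, sq_abs, hC]; linarith [Real.sin_sq_add_cos_sq (2 * Real.pi * q)]
    rw [hSC]
    have hC1 := abs_le.1 (Real.abs_cos_le_one (2 * Real.pi * q))
    rw [← hC] at hC1
    rw [← sq_abs ξ1, ← sq_abs ξ2]
    have h3 : -(|ξ1| * |ξ2| * |C|) ≤ ξ1 * ξ2 * C := by
      rw [← abs_mul, ← abs_mul]; exact neg_abs_le _
    have h4 : 0 ≤ |ξ1| * |ξ2| * (1 - |C|) ^ 2 := by positivity
    rw [← sq_abs C]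
    nlinarith [sq_nonneg (|ξ1| - |ξ2|)]
  have hR : S * (|ξ1| ^ (1/2:ℝ) * |ξ2| ^ (1/2:ℝ)) ≤ pR ξ1 ξ2 q := by
    apply le_of_sq_le_sq _ (pR_nonneg _ _ _)
    rw [mul_pow, mul_pow, ← Real.rpow_natCast (|ξ1| ^ _), ← Real.rpow_natCast (|ξ2| ^ _),
      ← Real.rpow_mul a1.le, ← Real.rpow_mul a2.le]
    norm_num
    exact hsq
  have hpos : 0 < S * (|ξ1| ^ (1/2:ℝ) * |ξ2| ^ (1/2:ℝ)) := by positivity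
  have hRp := lt_of_lt_of_le hpos hR
  refine (pj_le ξ1 ξ2 q hRp.ne').trans ?_
  calc 8 / √(pR ξ1 ξ2 q) ≤ 8 / √(S * (|ξ1| ^ (1/2:ℝ) * |ξ2| ^ (1/2:ℝ))) := by gcongr
    _ = _ := by
      rw [Real.sqrt_eq_rpow, Real.mul_rpow hS0.le (by positivity), Real.mul_rpow (by positivity) (by positivity),
        ← Real.rpow_mul a1.le, ← Real.rpow_mul a2.le, Real.rpow_neg hS0.le, Real.rpow_neg a1.le,
        Real.rpow_neg a2.le]
      norm_num
      field_simp

/-- Fourier weight -/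
noncomputable def wt (s η ξ : ℝ) : ℝ := |ξ| ^ (-s) * Real.exp (-η * |ξ|)

lemma wt_nonneg (s η ξ : ℝ) : 0 ≤ wt s η ξ := by unfold wt; positivity

lemma wt_meas (s η : ℝ) : Measurable (wt s η) := by unfold wt; fun_prop

lemma wt_lintegral (s η : ℝ) (hs : s < 1) (hη : 0 < η) :
    ∫⁻ ξ, ENNReal.ofReal (wt s η ξ) = ENNReal.ofReal (2 * Real.Gamma (1 - s) * η ^ (-(1 - s))) := by
  rw [← aux_weight_integral s η hs hη]
  exact (ofReal_integral_eq_lintegral_ofReal (aux_weight_integrable s η hs hη)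
    (ae_of_all _ (wt_nonneg s η))).symm

/-- integrable kernel -/
noncomputable def hk (x : ℝ) : ℝ := (1 + |x|) ^ (-(17/16):ℝ)

lemma hk_nonneg (x : ℝ) : 0 ≤ hk x := by unfold hk; positivity

lemma hk_meas : Measurable hk := by unfold hk; fun_prop

lemma hk_lintegral : ∃ C : ℝ, 0 < C ∧ ∫⁻ x, ENNReal.ofReal (hk x) = ENNReal.ofReal C := by
  have h := finite_integral_one_add_norm (E := ℝ) (μ := volume) (r := 17/16) (by simp; norm_num)
  have h2 : ∫⁻ x, ENNReal.ofReal (hk x) < ⊤ := by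
    simpa [hk, Real.norm_eq_abs] using h
  have h3 : ∫⁻ x, ENNReal.ofReal (hk x) ≠ 0 := by
    intro h0
    rw [lintegral_eq_zero_iff (by have := hk_meas; fun_prop)] at h0
    have : ∀ x, hk x ≠ 0 := fun x => by unfold hk; positivity
    have h4 : ∀ᵐ x : ℝ, False := by
      filter_upwards [h0] with x hx
      simp only [Pi.zero_apply, ENNReal.ofReal_eq_zero] at hx
      exact this x (le_antisymm hx (hk_nonneg x))
    simp at h4
    exact NeZero.ne _ h4
  exact ⟨_, ENNReal.toReal_pos h3 h2.ne, (ENNReal.ofReal_toReal h2.ne).symm⟩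

lemma core_pt (η u v : ℝ) (hη : 0 < η) (F G : ℝ) (hF : 0 ≤ F) (hG : 0 ≤ G) :
    F * G / (1 + |(|u| - |v|)|) ≤
      η ^ (-(1/16):ℝ) * ((F * F) * (hk (u - v) + hk (u + v)) + (G * G) * (hk (u - v) + hk (u + v))) + η * (F * G) := by
  set τ := |(|u| - |v|)| with hτ
  have hτ0 : 0 ≤ τ := abs_nonneg _
  have h1 : (1 + τ) ^ (-(17/16):ℝ) ≤ hk (u - v) + hk (u + v) := by
    have e : τ = |u - v| ∨ τ = |u + v| := by
      rw [hτ]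
      rcases abs_cases u with ⟨h, _⟩ | ⟨h, _⟩ <;> rcases abs_cases v with ⟨h', _⟩ | ⟨h', _⟩ <;> rw [h, h']
      · left; rfl
      · right; congr 1; ring
      · right; rw [← abs_neg]; congr 1; ring
      · left; rw [← abs_neg]; congr 1; ring
    rcases e with e | e
    · rw [e]; exact le_add_of_nonneg_right (hk_nonneg _)
    · rw [e]; exact le_add_of_nonneg_left (hk_nonneg _)
  have h2 : 1 / (1 + τ) ≤ η ^ (-(1/16):ℝ) * (1 + τ) ^ (-(17/16):ℝ) + η := by
    rcases le_total (1 + τ) (1 / η) with h | h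
    · have e : 1 / (1 + τ) = (1 + τ) ^ (1/16:ℝ) * (1 + τ) ^ (-(17/16):ℝ) := by
        rw [← Real.rpow_add (by positivity)]
        norm_num [Real.rpow_neg_one]
      rw [e]
      have : (1 + τ) ^ (1/16:ℝ) ≤ η ^ (-(1/16):ℝ) := by
        rw [Real.rpow_neg hη.le, ← Real.inv_rpow hη.le, ← one_div η]
        gcongr
      have h3 : 0 ≤ (1 + τ) ^ (-(17/16):ℝ) := by positivity
      nlinarith
    · have : 1 / (1 + τ) ≤ η := by
        rw [div_le_iff₀ (by positivity)]
        rw [div_le_iff₀ hη] at h; linarith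
      have : 0 ≤ η ^ (-(1/16):ℝ) * (1 + τ) ^ (-(17/16):ℝ) := by positivity
      linarith
  set H := hk (u - v) + hk (u + v) with hH
  have hH0 : 0 ≤ H := add_nonneg (hk_nonneg _) (hk_nonneg _)
  have hFG : 0 ≤ F * G := by positivity
  have hn : 0 ≤ η ^ (-(1/16):ℝ) := by positivity
  calc F * G / (1 + τ) = F * G * (1 / (1 + τ)) := by ring
    _ ≤ F * G * (η ^ (-(1/16):ℝ) * H + η) := by
        apply mul_le_mul_of_nonneg_left _ hFG
        refine h2.trans ?_
        gcongr
    _ = η ^ (-(1/16):ℝ) * ((F * G) * H) + η * (F * G) := by ring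
    _ ≤ _ := by
        have : F * G ≤ F * F + G * G := by nlinarith [sq_nonneg (F - G)]
        have h5 := mul_le_mul_of_nonneg_right this hH0
        have := mul_le_mul_of_nonneg_left h5 hn
        linarith

lemma core_lint : ∃ C : ℝ, 0 < C ∧ ∀ η : ℝ, 0 < η → η ≤ 1 →
    ∫⁻ z : ℝ × ℝ, ENNReal.ofReal (wt (5/16) η z.1 * wt (5/16) η z.2 / (1 + |(|z.1| - |z.2|)|)) ≤
      ENNReal.ofReal (C * η ^ (-(7/16):ℝ)) := by
  obtain ⟨H, hH, hHe⟩ := hk_lintegral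
  have hG1 : 0 < Real.Gamma (1 - 5/8) := Real.Gamma_pos_of_pos (by norm_num)
  have hG2 : 0 < Real.Gamma (1 - 5/16) := Real.Gamma_pos_of_pos (by norm_num)
  refine ⟨4 * H * (2 * Real.Gamma (1 - 5/8)) + (2 * Real.Gamma (1 - 5/16)) ^ 2, by positivity, ?_⟩
  intro η hη hη1
  set f := wt (5/16) η with hf
  have hfm : Measurable f := wt_meas _ _
  have hhm := hk_meas
  have hf0 : ∀ x, 0 ≤ f x := wt_nonneg _ _
  have hff : ∀ x, x ≠ 0 → f x * f x = wt (5/8) (2*η) x := by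
    intro x hx
    have : 0 < |x| := abs_pos.2 hx
    simp only [hf, wt]
    rw [show ∀ a b : ℝ, a * b * (a * b) = (a * a) * (b * b) by intros; ring, ← Real.rpow_add this, ← Real.exp_add]
    congr 2 <;> ring
  have hF2 : ∫⁻ x, ENNReal.ofReal (f x * f x) ≤ ENNReal.ofReal (2 * Real.Gamma (1 - 5/8) * η ^ (-(3/8):ℝ)) := by
    have : ∫⁻ x, ENNReal.ofReal (f x * f x) = ∫⁻ x, ENNReal.ofReal (wt (5/8) (2*η) x) := by
      apply lintegral_congr_ae
      filter_upwards [Measure.ae_ne volume (0:ℝ)] with x hx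
      rw [hff x hx]
    rw [this, wt_lintegral _ _ (by norm_num) (by positivity)]
    apply ENNReal.ofReal_le_ofReal
    apply mul_le_mul_of_nonneg_left _ (by positivity)
    rw [show (-(1 - 5/8):ℝ) = -(3/8) by norm_num]
    exact Real.rpow_le_rpow_of_nonpos hη (by linarith) (by norm_num)
  have hF1 : ∫⁻ x, ENNReal.ofReal (f x) = ENNReal.ofReal (2 * Real.Gamma (1 - 5/16) * η ^ (-(11/16):ℝ)) := by
    rw [hf, wt_lintegral _ _ (by norm_num) hη]; norm_num
  -- convolution
  have hsub : ∀ a : ℝ, ∫⁻ y, ENNReal.ofReal (hk (a - y)) = ENNReal.ofReal H := by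
    intro a; rw [← hHe]; exact lintegral_sub_left_eq_self (fun y => ENNReal.ofReal (hk y)) a
  have hsub' : ∀ a : ℝ, ∫⁻ y, ENNReal.ofReal (hk (y - a)) = ENNReal.ofReal H := by
    intro a; rw [← hHe]; exact lintegral_sub_right_eq_self (fun y => ENNReal.ofReal (hk y)) a
  have hadd : ∀ a : ℝ, ∫⁻ y, ENNReal.ofReal (hk (a + y)) = ENNReal.ofReal H := by
    intro a; rw [← hHe]; exact lintegral_add_left_eq_self (fun y => ENNReal.ofReal (hk y)) a
  have hadd' : ∀ a : ℝ, ∫⁻ y, ENNReal.ofReal (hk (y + a)) = ENNReal.ofReal H := by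
    intro a; rw [← hHe]; exact lintegral_add_right_eq_self (fun y => ENNReal.ofReal (hk y)) a
  set Q := ∫⁻ x, ENNReal.ofReal (f x * f x) with hQ
  have hA : ∫⁻ z : ℝ × ℝ, ENNReal.ofReal (f z.1 * f z.1) * (ENNReal.ofReal (hk (z.1 - z.2)) + ENNReal.ofReal (hk (z.1 + z.2))) = Q * (ENNReal.ofReal H + ENNReal.ofReal H) := by
    rw [Measure.volume_eq_prod, lintegral_prod _ (by fun_prop)]
    rw [hQ, ← lintegral_mul_const _ (by fun_prop)]
    apply lintegral_congr; intro x
    simp only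
    rw [lintegral_const_mul _ (by fun_prop), lintegral_add_left (by fun_prop), hsub, hadd]
  have hB : ∫⁻ z : ℝ × ℝ, ENNReal.ofReal (f z.2 * f z.2) * (ENNReal.ofReal (hk (z.1 - z.2)) + ENNReal.ofReal (hk (z.1 + z.2))) = Q * (ENNReal.ofReal H + ENNReal.ofReal H) := by
    rw [Measure.volume_eq_prod, lintegral_prod_symm _ (by fun_prop)]
    rw [hQ, ← lintegral_mul_const _ (by fun_prop)]
    apply lintegral_congr; intro x
    simp only
    rw [lintegral_const_mul _ (by fun_prop), lintegral_add_left (by fun_prop), hsub', hadd']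
  have hC : ∫⁻ z : ℝ × ℝ, ENNReal.ofReal (f z.1) * ENNReal.ofReal (f z.2) =
      (∫⁻ x, ENNReal.ofReal (f x)) * (∫⁻ x, ENNReal.ofReal (f x)) := by
    rw [Measure.volume_eq_prod]
    exact lintegral_prod_mul (f := fun x => ENNReal.ofReal (f x)) (g := fun x => ENNReal.ofReal (f x)) (by fun_prop) (by fun_prop)
  set E := ENNReal.ofReal (η ^ (-(1/16):ℝ)) with hE
  calc _ ≤ ∫⁻ z : ℝ × ℝ, (E *
        (ENNReal.ofReal (f z.1 * f z.1) * (ENNReal.ofReal (hk (z.1 - z.2)) + ENNReal.ofReal (hk (z.1 + z.2))) +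
         ENNReal.ofReal (f z.2 * f z.2) * (ENNReal.ofReal (hk (z.1 - z.2)) + ENNReal.ofReal (hk (z.1 + z.2)))) +
         ENNReal.ofReal η * (ENNReal.ofReal (f z.1) * ENNReal.ofReal (f z.2))) := by
        apply lintegral_mono
        intro z
        simp only
        have a1 := hf0 z.1
        have a2 := hf0 z.2
        have a3 := hk_nonneg (z.1 - z.2)
        have a4 := hk_nonneg (z.1 + z.2)
        rw [← ENNReal.ofReal_add a3 a4, ← ENNReal.ofReal_mul (by positivity), ← ENNReal.ofReal_mul (by positivity),
          ← ENNReal.ofReal_add (by positivity) (by positivity), ← ENNReal.ofReal_mul (by positivity),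
          ← ENNReal.ofReal_mul (by positivity), ← ENNReal.ofReal_mul (by positivity),
          ← ENNReal.ofReal_add (by positivity) (by positivity)]
        exact ENNReal.ofReal_le_ofReal (core_pt η z.1 z.2 hη _ _ a1 a2)
    _ = E * (Q * (ENNReal.ofReal H + ENNReal.ofReal H) + Q * (ENNReal.ofReal H + ENNReal.ofReal H)) +
        ENNReal.ofReal η * ((∫⁻ x, ENNReal.ofReal (f x)) * (∫⁻ x, ENNReal.ofReal (f x))) := by
        rw [lintegral_add_left (by fun_prop), lintegral_const_mul _ (by fun_prop), lintegral_add_left (by fun_prop),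
          lintegral_const_mul _ (by fun_prop), hA, hB, hC]
    _ ≤ E * (ENNReal.ofReal (2 * Real.Gamma (1 - 5/8) * η ^ (-(3/8):ℝ)) * (ENNReal.ofReal H + ENNReal.ofReal H) + ENNReal.ofReal (2 * Real.Gamma (1 - 5/8) * η ^ (-(3/8):ℝ)) * (ENNReal.ofReal H + ENNReal.ofReal H)) +
        ENNReal.ofReal η * (ENNReal.ofReal (2 * Real.Gamma (1 - 5/16) * η ^ (-(11/16):ℝ)) * ENNReal.ofReal (2 * Real.Gamma (1 - 5/16) * η ^ (-(11/16):ℝ))) := by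
        rw [hF1]; gcongr
    _ ≤ _ := by
        rw [hE, ← ENNReal.ofReal_add (by positivity) (by positivity), ← ENNReal.ofReal_mul (by positivity),
          ← ENNReal.ofReal_mul (by positivity), ← ENNReal.ofReal_mul (by positivity),
          ← ENNReal.ofReal_add (by positivity) (by positivity), ← ENNReal.ofReal_mul (by positivity),
          ← ENNReal.ofReal_add (by positivity) (by positivity)]
        apply ENNReal.ofReal_le_ofReal
        have e1 : η ^ (-(1/16):ℝ) * η ^ (-(3/8):ℝ) = η ^ (-(7/16):ℝ) := by
          rw [← Real.rpow_add hη]; norm_num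
        have hg : η * (η ^ (-(11/16):ℝ) * η ^ (-(11/16):ℝ)) = η ^ (-(3/8):ℝ) := by
          rw [← Real.rpow_add hη]
          nth_rewrite 1 [← Real.rpow_one η]
          rw [← Real.rpow_add hη]; norm_num
        have e2 : η ^ (-(3/8):ℝ) ≤ η ^ (-(7/16):ℝ) :=
          Real.rpow_le_rpow_of_exponent_ge hη hη1 (by norm_num)
        have e3 := mul_le_mul_of_nonneg_left e2 (sq_nonneg (2 * Real.Gamma (1 - 5/16)))
        rw [← hg] at e3
        refine le_trans (le_of_eq ?_) (le_trans (add_le_add_right e3 (4 * H * (2 * Real.Gamma (1 - 5/8)) * η ^ (-(7/16):ℝ))) (le_of_eq ?_))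
        · rw [← e1]; ring
        · ring

/-- unit cell in one dimension -/
abbrev I1 : Set ℝ := Set.Icc (-(1/2) : ℝ) (1/2)

lemma T3_restrict : (volume : Measure (Fin 3 → ℝ)).restrict T3 =
    Measure.pi (fun _ : Fin 3 => (volume : Measure ℝ).restrict I1) := by
  rw [T3, volume_pi, Measure.restrict_pi_pi]

lemma T3_meas : MeasurableSet T3 := MeasurableSet.univ_pi (fun _ => measurableSet_Icc)

lemma edisp_cont : Continuous edisp := by unfold edisp; fun_prop

lemma prod_T3 (f : Fin 3 → ℝ → ℂ) :
    ∫ p in T3, ∏ j, f j (p j) = ∏ j, ∫ x in I1, f j x := by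
  rw [T3_restrict]
  exact integral_fintype_prod_eq_prod f

lemma phase_eq (ξ1 ξ2 α β : ℝ) (q p : Fin 3 → ℝ) :
    Complex.exp (Complex.I * ((ξ1 * (α - edisp p) + ξ2 * (β - edisp (p + q)) : ℝ) : ℂ)) =
    Complex.exp (Complex.I * ((ξ1 * (α - 3) + ξ2 * (β - 3) : ℝ) : ℂ)) *
    ∏ j, Complex.exp (Complex.I *
    ((ξ1 * Real.cos (2 * Real.pi * p j) + ξ2 * Real.cos (2 * Real.pi * (p j + q j)) : ℝ) : ℂ)) := by
  rw [← Complex.exp_sum, ← Complex.exp_add, ← Finset.mul_sum, ← mul_add, ← Complex.ofReal_sum, ← Complex.ofReal_add]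
  congr 3
  simp only [edisp, Fin.sum_univ_three, Pi.add_apply]
  ring

lemma phase_int (ξ1 ξ2 α β : ℝ) (q : Fin 3 → ℝ) :
    ‖∫ p in T3, Complex.exp (Complex.I * ((ξ1 * (α - edisp p) + ξ2 * (β - edisp (p + q)) : ℝ) : ℂ))‖
      = ∏ j, ‖pj ξ1 ξ2 (q j)‖ := by
  simp_rw [phase_eq]
  rw [integral_const_mul, norm_mul, mul_comm Complex.I, Complex.norm_exp_ofReal_mul_I, one_mul,
    prod_T3 (fun j x => Complex.exp (Complex.I *
    ((ξ1 * Real.cos (2 * Real.pi * x) + ξ2 * Real.cos (2 * Real.pi * (x + q j)) : ℝ) : ℂ))), norm_prod]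
  rfl

/-- the real kernel -/
noncomputable def Kr (η t : ℝ) : ℝ :=
  2 * ∫ ξ in Set.Ioi (0:ℝ), ξ ^ (-(1/16):ℝ) * Real.exp (-η * ξ) * Real.cos (ξ * t)

lemma Kr_eq (η t : ℝ) (hη : 0 < η) :
    ∫ ξ : ℝ, (wt (1/16) η ξ : ℂ) * Complex.exp (Complex.I * ((ξ * t : ℝ) : ℂ)) = (Kr η t : ℂ) :=
  aux_kernel_eq (1/16) (by norm_num) η t hη

lemma res_le_Kr : ∃ C : ℝ, 0 < C ∧ ∀ η t : ℝ, 0 < η →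
    1 / √(t ^ 2 + η ^ 2) ≤ C * η ^ (-(1/16):ℝ) * Kr η t := by
  obtain ⟨c, hc, h⟩ := aux_kernel_lower (1/16) (by norm_num) (by norm_num)
  refine ⟨1 / c, by positivity, fun η t hη => ?_⟩
  have h1 := h η t hη
  set M := √(t ^ 2 + η ^ 2) with hM
  have hηM : η ≤ M := Real.le_sqrt_of_sq_le (by nlinarith [sq_nonneg t])
  have hM0 : 0 < M := by linarith
  have h2 : M ^ ((1/16:ℝ) - 1) ≤ 1 / c * Kr η t := by
    unfold Kr
    rw [div_mul_eq_mul_div, one_mul, le_div_iff₀ hc]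
    linarith
  have h3 : M ^ (-(1/16):ℝ) ≤ η ^ (-(1/16):ℝ) := Real.rpow_le_rpow_of_nonpos hη hηM (by norm_num)
  calc 1 / M = M ^ (-(1/16):ℝ) * M ^ ((1/16:ℝ) - 1) := by
        rw [← Real.rpow_add hM0]; norm_num [Real.rpow_neg_one]
    _ ≤ η ^ (-(1/16):ℝ) * (1 / c * Kr η t) := by gcongr
    _ = _ := by ring

lemma Kr_pos (η t : ℝ) (hη : 0 < η) : 0 ≤ Kr η t := by
  obtain ⟨C, hC, h⟩ := res_le_Kr
  have h1 := h η t hη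
  have h2 : 0 ≤ C * η ^ (-(1/16):ℝ) * Kr η t := le_trans (by positivity) h1
  exact nonneg_of_mul_nonneg_right h2 (by positivity)

lemma wt_integrable (s η : ℝ) (hs : s < 1) (hη : 0 < η) : Integrable (wt s η) :=
  aux_weight_integrable s η hs hη

lemma J_kernel (η α β : ℝ) (q : Fin 3 → ℝ) (hη : 0 < η) :
    Integrable (fun p => Kr η (α - edisp p) * Kr η (β - edisp (p + q))) (volume.restrict T3) ∧
    ENNReal.ofReal (∫ p in T3, Kr η (α - edisp p) * Kr η (β - edisp (p + q))) ≤
      ∫⁻ z : ℝ × ℝ, ENNReal.ofReal (wt (1/16) η z.1 * wt (1/16) η z.2 * ∏ j, ‖pj z.1 z.2 (q j)‖) := by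
  have hwm := wt_meas (1/16) η
  have hec := edisp_cont
  let G : (Fin 3 → ℝ) → ℝ × ℝ → ℂ := fun p z => ((wt (1/16) η z.1 : ℂ) * (wt (1/16) η z.2 : ℂ)) *
    Complex.exp (Complex.I * ((z.1 * (α - edisp p) + z.2 * (β - edisp (p + q)) : ℝ) : ℂ))
  haveI : IsFiniteMeasure ((volume : Measure (Fin 3 → ℝ)).restrict T3) := by
    rw [T3_restrict]; infer_instance
  have hG : Integrable (Function.uncurry G) ((volume.restrict T3).prod volume) := by
    have h1 := (wt_integrable (1/16) η (by norm_num) hη).ofReal (𝕜 := ℂ)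
    have h2 := (h1.mul_prod h1).comp_snd (volume.restrict T3)
    refine h2.mono ?_ ?_
    · apply Measurable.aestronglyMeasurable
      simp only [G, Function.uncurry_def]
      fun_prop
    · filter_upwards with z
      simp only [G, Function.uncurry_def]
      rw [norm_mul _ (Complex.exp _), mul_comm Complex.I, Complex.norm_exp_ofReal_mul_I, mul_one]
      exact le_rfl
  have hin : ∀ p, ∫ z, G p z = ((Kr η (α - edisp p) * Kr η (β - edisp (p + q)) : ℝ) : ℂ) := by
    intro p
    rw [Complex.ofReal_mul, ← Kr_eq _ _ hη, ← Kr_eq _ _ hη, ← integral_prod_mul, Measure.volume_eq_prod]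
    congr 1; ext z
    simp only [G]
    rw [Complex.ofReal_add, mul_add, Complex.exp_add]; ring
  have hi := hG.integral_prod_left
  simp only [Function.uncurry_def, hin] at hi
  refine ⟨by simpa using hi.re, ?_⟩
  have hsw := integral_integral_swap hG
  simp only [hin] at hsw
  rw [integral_complex_ofReal] at hsw
  have h0 : 0 ≤ ∫ p in T3, Kr η (α - edisp p) * Kr η (β - edisp (p + q)) :=
    integral_nonneg fun p => mul_nonneg (Kr_pos _ _ hη) (Kr_pos _ _ hη)
  have h1 : ENNReal.ofReal (∫ p in T3, Kr η (α - edisp p) * Kr η (β - edisp (p + q))) =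
      ‖∫ z : ℝ × ℝ, ∫ p in T3, G p z‖ₑ := by
    rw [← hsw, ← ofReal_norm, Complex.norm_real, Real.norm_of_nonneg h0]
  rw [h1]
  refine (enorm_integral_le_lintegral_enorm _).trans (lintegral_mono fun z => ?_)
  rw [← ofReal_norm]
  apply ENNReal.ofReal_le_ofReal
  simp only [G]
  rw [integral_const_mul, norm_mul, phase_int, norm_mul, Complex.norm_real, Complex.norm_real,
    Real.norm_of_nonneg (wt_nonneg _ _ _), Real.norm_of_nonneg (wt_nonneg _ _ _)]

lemma prod_pj_le (q : Fin 3 → ℝ) (j : Fin 3) (u v : ℝ) (hq : Real.sin (2 * Real.pi * q j) ≠ 0)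
    (hu : u ≠ 0) (hv : v ≠ 0) :
    ∏ i, ‖pj u v (q i)‖ ≤ (8 * |Real.sin (2 * Real.pi * q j)| ^ (-(1/2):ℝ) *
      (|u| ^ (-(1/4):ℝ) * |v| ^ (-(1/4):ℝ))) * (65 / (1 + |(|u| - |v|)|)) := by
  rw [Fin.prod_univ_succAbove _ j]
  have h := pj_le_rpow u v (q j) hq hu hv
  refine mul_le_mul h ?_ (by positivity) (by positivity)
  rw [Fin.prod_univ_two]
  have h1 := pj_sq_le u v (q (j.succAbove 0))
  have h2 := pj_sq_le u v (q (j.succAbove 1))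
  nlinarith [sq_nonneg (‖pj u v (q (j.succAbove 0))‖ - ‖pj u v (q (j.succAbove 1))‖)]

lemma J_bound : ∃ C : ℝ, 0 < C ∧ ∀ η α β : ℝ, ∀ q : Fin 3 → ℝ, ∀ j : Fin 3, 0 < η → η ≤ 1 →
    Real.sin (2 * Real.pi * q j) ≠ 0 →
    ∫⁻ p in T3, ENNReal.ofReal (1 / √((α - edisp p) ^ 2 + η ^ 2) * (1 / √((β - edisp (p + q)) ^ 2 + η ^ 2))) ≤
      ENNReal.ofReal (C * η ^ (-(9/16):ℝ) * |Real.sin (2 * Real.pi * q j)| ^ (-(1/2):ℝ)) := by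
  obtain ⟨C1, hC1, h1⟩ := res_le_Kr
  obtain ⟨C2, hC2, h2⟩ := core_lint
  refine ⟨C1 ^ 2 * (8 * 65) * C2, by positivity, ?_⟩
  intro η α β q j hη hη1 hq
  obtain ⟨hi, hK⟩ := J_kernel η α β q hη
  set S := |Real.sin (2 * Real.pi * q j)| with hS
  have hS0 : 0 < S := abs_pos.2 hq
  have hae : ∀ᵐ z : ℝ × ℝ, z.1 ≠ 0 ∧ z.2 ≠ 0 := by
    rw [Measure.volume_eq_prod]
    have a1 : ∀ᵐ x : ℝ, x ≠ 0 := Measure.ae_ne volume (0:ℝ)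
    exact (Measure.quasiMeasurePreserving_fst.ae a1).and (Measure.quasiMeasurePreserving_snd.ae a1)
  have hJ : ∫⁻ z : ℝ × ℝ, ENNReal.ofReal (wt (1/16) η z.1 * wt (1/16) η z.2 * ∏ j, ‖pj z.1 z.2 (q j)‖) ≤
      ENNReal.ofReal (8 * 65 * S ^ (-(1/2):ℝ)) * ENNReal.ofReal (C2 * η ^ (-(7/16):ℝ)) := by
    refine le_trans ?_ (mul_le_mul_right (h2 η hη hη1) _)
    rw [← lintegral_const_mul' _ _ ENNReal.ofReal_ne_top]
    apply lintegral_mono_ae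
    filter_upwards [hae] with z hz
    rw [← ENNReal.ofReal_mul (by positivity)]
    apply ENNReal.ofReal_le_ofReal
    have hp := prod_pj_le q j z.1 z.2 hq hz.1 hz.2
    have w1 := wt_nonneg (1/16) η z.1
    have w2 := wt_nonneg (1/16) η z.2
    have key : ∀ x : ℝ, x ≠ 0 → wt (1/16) η x * |x| ^ (-(1/4):ℝ) = wt (5/16) η x := by
      intro x hx
      unfold wt
      rw [mul_right_comm, ← Real.rpow_add (abs_pos.2 hx)]
      norm_num
    rw [← key z.1 hz.1, ← key z.2 hz.2]
    refine (mul_le_mul_of_nonneg_left hp (mul_nonneg w1 w2)).trans (le_of_eq ?_)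
    ring
  calc _ ≤ ∫⁻ p in T3, ENNReal.ofReal ((C1 * η ^ (-(1/16):ℝ)) ^ 2 * (Kr η (α - edisp p) * Kr η (β - edisp (p + q)))) := by
        apply lintegral_mono; intro p
        apply ENNReal.ofReal_le_ofReal
        refine (mul_le_mul (h1 η _ hη) (h1 η _ hη) (by positivity)
          (mul_nonneg (by positivity) (Kr_pos _ _ hη))).trans (le_of_eq ?_)
        ring
    _ = ENNReal.ofReal ((C1 * η ^ (-(1/16):ℝ)) ^ 2) * ENNReal.ofReal (∫ p in T3, Kr η (α - edisp p) * Kr η (β - edisp (p + q))) := by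
        rw [ofReal_integral_eq_lintegral_ofReal hi
          (ae_of_all _ fun p => mul_nonneg (Kr_pos _ _ hη) (Kr_pos _ _ hη)),
          ← lintegral_const_mul' _ _ ENNReal.ofReal_ne_top]
        apply lintegral_congr; intro p
        rw [← ENNReal.ofReal_mul (by positivity)]
    _ ≤ ENNReal.ofReal ((C1 * η ^ (-(1/16):ℝ)) ^ 2) * (ENNReal.ofReal (8 * 65 * S ^ (-(1/2):ℝ)) * ENNReal.ofReal (C2 * η ^ (-(7/16):ℝ))) := by
        gcongr
        exact hK.trans hJ
    _ = _ := by
        rw [← ENNReal.ofReal_mul (by positivity), ← ENNReal.ofReal_mul (by positivity)]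
        congr 1
        have : η ^ (-(9/16):ℝ) = (η ^ (-(1/16):ℝ)) ^ 2 * η ^ (-(7/16):ℝ) := by
          rw [← Real.rpow_natCast, ← Real.rpow_mul hη.le, ← Real.rpow_add hη]; norm_num
        rw [this]; ring

/-- distance to the half-integers -/
noncomputable def dd (t : ℝ) : ℝ := min (cdist t 0) (cdist t (1/2))

lemma dd_nonneg (t : ℝ) : 0 ≤ dd t := le_min (abs_nonneg _) (abs_nonneg _)

lemma dd_meas : Measurable dd := by
  unfold dd cdist
  simp_rw [round_eq]
  fun_prop

lemma dd_add_int (t : ℝ) (n : ℤ) : dd (t + n) = dd t := by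
  unfold dd cdist
  rw [show t + n - 0 = (t - 0) + n by ring, show t + n - 1/2 = (t - 1/2) + n by ring,
    round_add_intCast, round_add_intCast]
  push_cast
  congr 2 <;> ring

lemma dd_eq (y : ℝ) (hy : |y| ≤ 1) : ∃ k ∈ Finset.Icc (-2:ℤ) 3, dd y = |y - k / 2| := by
  have hy' := abs_le.1 hy
  have r1 := abs_le.1 (abs_sub_round y)
  have r2 := abs_le.1 (abs_sub_round (y - 1/2))
  unfold dd cdist
  rcases min_choice |y - 0 - (round (y - 0) : ℝ)| |y - 1/2 - (round (y - 1/2) : ℝ)| with h | h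
  · refine ⟨2 * round y, ?_, ?_⟩
    · rw [Finset.mem_Icc]
      have h1 : ((round y : ℤ) : ℝ) < 2 := by linarith
      have h2 : (-2:ℝ) < ((round y : ℤ) : ℝ) := by linarith
      have h1' : round y < 2 := by exact_mod_cast h1
      have h2' : -2 < round y := by exact_mod_cast h2
      constructor <;> linarith
    · rw [h]; push_cast; congr 1; rw [sub_zero]; ring
  · refine ⟨2 * round (y - 1/2) + 1, ?_, ?_⟩
    · rw [Finset.mem_Icc]
      have hr : round (y - 1/2) = ⌊y⌋ := by rw [round_eq]; congr 1; ring
      rw [hr]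
      have h1 : ⌊y⌋ ≤ 1 := by
        have : ⌊y⌋ < 2 := Int.floor_lt.2 (by push_cast; linarith)
        omega
      have h2 : -1 ≤ ⌊y⌋ := Int.le_floor.2 (by push_cast; linarith)
      constructor <;> linarith
    · rw [h]; push_cast; congr 1; ring

/-- regularized weight -/
noncomputable def dw (a η t : ℝ) : ℝ := (η + dd t) ^ (-a)

lemma dw_meas (a η : ℝ) : Measurable (dw a η) := by
  have := dd_meas
  unfold dw; fun_prop

lemma dw_nonneg (a η t : ℝ) (hη : 0 < η) : 0 ≤ dw a η t := by
  have := dd_nonneg t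
  unfold dw; positivity

lemma dw_le (a η t : ℝ) (ha : 0 ≤ a) (hη : 0 < η) : dw a η t ≤ η ^ (-a) :=
  Real.rpow_le_rpow_of_nonpos hη (by linarith [dd_nonneg t]) (by linarith)

lemma pow_sing (a : ℝ) (ha : 0 < a) (ha1 : a < 1) : ∃ C : ℝ, 0 < C ∧ ∀ η c : ℝ, 0 < η →
    ∫⁻ x in I1, ENNReal.ofReal ((η + |x - c|) ^ (-a)) ≤ ENNReal.ofReal C := by
  have hi : IntegrableOn (fun x : ℝ => |x| ^ (-a)) (Set.Icc (-1) 1) := by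
    have h := (wt_integrable a 1 ha1 one_pos).const_mul (Real.exp 1)
    refine Integrable.mono h.integrableOn (by apply Measurable.aestronglyMeasurable; fun_prop) ?_
    filter_upwards [ae_restrict_mem measurableSet_Icc] with x hx
    have : |x| ≤ 1 := abs_le.2 hx
    rw [Real.norm_of_nonneg (by positivity), Real.norm_of_nonneg (by have := wt_nonneg a 1 x; positivity)]
    unfold wt
    have h2 : 1 ≤ Real.exp 1 * Real.exp (-1 * |x|) := by
      rw [← Real.exp_add]; apply Real.one_le_exp; linarith
    have : 0 ≤ |x| ^ (-a) := by positivity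
    nlinarith
  have hn : 0 ≤ ∫ x in Set.Icc (-1:ℝ) 1, |x| ^ (-a) := integral_nonneg fun x => by positivity
  refine ⟨1 + ∫ x in Set.Icc (-1:ℝ) 1, |x| ^ (-a), by positivity, ?_⟩
  intro η c hη
  rw [ENNReal.ofReal_add zero_le_one hn, ofReal_integral_eq_lintegral_ofReal hi
    (ae_of_all _ fun x => by positivity)]
  have hshift : ∫⁻ x in Set.Icc (-1:ℝ) 1, ENNReal.ofReal (|x| ^ (-a)) =
      ∫⁻ x, (Set.Icc (-1:ℝ) 1).indicator (fun x => ENNReal.ofReal (|x| ^ (-a))) (x - c) := by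
    rw [← lintegral_indicator measurableSet_Icc]
    exact (lintegral_sub_right_eq_self ((Set.Icc (-1:ℝ) 1).indicator (fun x => ENNReal.ofReal (|x| ^ (-a)))) c).symm
  rw [hshift]
  have hone : ENNReal.ofReal 1 = ∫⁻ x in I1, 1 := by
    rw [lintegral_const, Measure.restrict_apply_univ, Real.volume_Icc]; norm_num
  rw [hone]
  refine le_trans ?_ (add_le_add_right (setLIntegral_le_lintegral I1 _) _)
  rw [← lintegral_add_left measurable_const]
  apply lintegral_mono_ae
  filter_upwards [ae_restrict_of_ae (Measure.ae_ne volume c)] with x hx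
  have hxc : 0 < |x - c| := abs_pos.2 (sub_ne_zero.2 hx)
  by_cases h : |x - c| ≤ 1
  · rw [Set.indicator_of_mem (Set.mem_Icc.2 (abs_le.1 h))]
    refine le_trans ?_ le_add_self
    apply ENNReal.ofReal_le_ofReal
    exact Real.rpow_le_rpow_of_nonpos hxc (by linarith) (by linarith)
  · refine le_trans ?_ le_self_add
    rw [← ENNReal.ofReal_one]
    apply ENNReal.ofReal_le_ofReal
    apply Real.rpow_le_one_of_one_le_of_nonpos <;> linarith

lemma dw_lint (a : ℝ) (ha : 0 < a) (ha1 : a < 1) : ∃ C : ℝ, 0 < C ∧ ∀ η r : ℝ, 0 < η →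
    ∫⁻ x in I1, ENNReal.ofReal (dw a η (x - r)) ≤ ENNReal.ofReal C := by
  obtain ⟨C, hC, h⟩ := pow_sing a ha ha1
  refine ⟨6 * C, by positivity, fun η r hη => ?_⟩
  set r0 := r - round r with hr0
  have hr : |r0| ≤ 1/2 := abs_sub_round r
  calc _ ≤ ∫⁻ x in I1, ∑ k ∈ Finset.Icc (-2:ℤ) 3, ENNReal.ofReal ((η + |x - (r0 + k/2)|) ^ (-a)) := by
        apply setLIntegral_mono' measurableSet_Icc
        intro x hx
        have hx' : |x| ≤ 1/2 := abs_le.2 hx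
        have e : dd (x - r) = dd (x - r0) := by
          rw [← dd_add_int (x - r) (round r)]; congr 1; rw [hr0]; ring
        obtain ⟨k, hk, hk2⟩ := dd_eq (x - r0) (by
          calc |x - r0| ≤ |x| + |r0| := abs_sub _ _
            _ ≤ 1 := by linarith)
        unfold dw
        rw [e, hk2, sub_sub]
        exact Finset.single_le_sum (f := fun k : ℤ => ENNReal.ofReal ((η + |x - (r0 + k/2)|) ^ (-a)))
          (fun _ _ => zero_le) hk
    _ = ∑ k ∈ Finset.Icc (-2:ℤ) 3, ∫⁻ x in I1, ENNReal.ofReal ((η + |x - (r0 + k/2)|) ^ (-a)) := by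
        rw [lintegral_finsetSum]; intro k _; fun_prop
    _ ≤ ∑ k ∈ Finset.Icc (-2:ℤ) 3, ENNReal.ofReal C := Finset.sum_le_sum fun k _ => h _ _ hη
    _ = _ := by
        rw [Finset.sum_const, ENNReal.ofReal_mul (by norm_num)]; norm_num
        rfl

lemma dw_int (a : ℝ) (ha : 0 < a) (ha1 : a < 1) : ∃ C : ℝ, 0 < C ∧ ∀ η r : ℝ, 0 < η →
    IntegrableOn (fun x => dw a η (x - r)) I1 ∧ ∫ x in I1, dw a η (x - r) ≤ C := by
  obtain ⟨C, hC, h⟩ := dw_lint a ha ha1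
  refine ⟨C, hC, fun η r hη => ?_⟩
  have hm := dw_meas a η
  have hnn : ∀ x, 0 ≤ dw a η (x - r) := fun x => dw_nonneg _ _ _ hη
  constructor
  · refine ⟨by apply Measurable.aestronglyMeasurable; fun_prop, ?_⟩
    rw [hasFiniteIntegral_iff_ofReal (ae_of_all _ hnn)]
    exact lt_of_le_of_lt (h η r hη) ENNReal.ofReal_lt_top
  · rw [integral_eq_lintegral_of_nonneg_ae (ae_of_all _ hnn) (by apply Measurable.aestronglyMeasurable; fun_prop)]
    exact ENNReal.toReal_le_of_le_ofReal hC.le (h η r hη)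

lemma T_kernel (η α B : ℝ) (g : ℝ → ℝ) (hg : Measurable g) (hg0 : ∀ x, 0 ≤ g x) (hgB : ∀ x, g x ≤ B) (hη : 0 < η) :
    Integrable (fun p => Kr η (α - edisp p) * g (p 2)) (volume.restrict T3) ∧
    ENNReal.ofReal (∫ p in T3, Kr η (α - edisp p) * g (p 2)) ≤
      ∫⁻ ξ : ℝ, ENNReal.ofReal (wt (1/16) η ξ * (‖pj ξ 0 0‖ ^ 2 * ∫ x in I1, g x)) := by
  have hwm := wt_meas (1/16) η
  have hec := edisp_cont
  let G : (Fin 3 → ℝ) → ℝ → ℂ := fun p ξ => (wt (1/16) η ξ : ℂ) * ((g (p 2) : ℂ) *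
    Complex.exp (Complex.I * ((ξ * (α - edisp p) : ℝ) : ℂ)))
  have : IsFiniteMeasure ((volume : Measure (Fin 3 → ℝ)).restrict T3) := by
    rw [T3_restrict]; infer_instance
  have hG : Integrable (Function.uncurry G) ((volume.restrict T3).prod volume) := by
    have h1 := (wt_integrable (1/16) η (by norm_num) hη).mul_const B
    have h2 := h1.comp_snd (volume.restrict T3)
    refine h2.mono ?_ ?_
    · apply Measurable.aestronglyMeasurable
      simp only [G, Function.uncurry_def]
      fun_prop
    · filter_upwards with z
      simp only [G, Function.uncurry_def]
      rw [norm_mul, norm_mul, mul_comm Complex.I, Complex.norm_exp_ofReal_mul_I, mul_one, norm_mul,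
        Complex.norm_real, Complex.norm_real]
      gcongr
      rw [Real.norm_of_nonneg (hg0 _)]
      exact (hgB _).trans (le_abs_self _)
  have hin : ∀ p, ∫ z, G p z = ((Kr η (α - edisp p) * g (p 2) : ℝ) : ℂ) := by
    intro p
    rw [Complex.ofReal_mul, ← Kr_eq _ _ hη, ← integral_mul_const]
    congr 1; ext z
    simp only [G]
    ring
  have hi := hG.integral_prod_left
  simp only [Function.uncurry_def, hin] at hi
  refine ⟨by simpa using hi.re, ?_⟩
  have hsw := integral_integral_swap hG
  simp only [hin] at hsw
  rw [integral_complex_ofReal] at hsw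
  have h0 : 0 ≤ ∫ p in T3, Kr η (α - edisp p) * g (p 2) :=
    integral_nonneg fun p => mul_nonneg (Kr_pos _ _ hη) (hg0 _)
  have h1 : ENNReal.ofReal (∫ p in T3, Kr η (α - edisp p) * g (p 2)) =
      ‖∫ z : ℝ, ∫ p in T3, G p z‖ₑ := by
    rw [← hsw, ← ofReal_norm, Complex.norm_real, Real.norm_of_nonneg h0]
  rw [h1]
  refine (enorm_integral_le_lintegral_enorm _).trans (lintegral_mono fun ξ => ?_)
  rw [← ofReal_norm]
  apply ENNReal.ofReal_le_ofReal
  simp only [G]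
  rw [integral_const_mul, norm_mul, Complex.norm_real, Real.norm_of_nonneg (wt_nonneg _ _ _)]
  refine mul_le_mul_of_nonneg_left ?_ (wt_nonneg _ _ _)
  let e : ℝ → ℂ := fun x => Complex.exp (Complex.I *
    ((ξ * Real.cos (2 * Real.pi * x) + 0 * Real.cos (2 * Real.pi * (x + 0)) : ℝ) : ℂ))
  have he : ∀ x, ‖e x‖ = 1 := fun x => by
    simp only [e]; rw [mul_comm]; exact Complex.norm_exp_ofReal_mul_I _
  have hfac : ∀ p : Fin 3 → ℝ, (g (p 2) : ℂ) * Complex.exp (Complex.I * ((ξ * (α - edisp p) : ℝ) : ℂ)) =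
      Complex.exp (Complex.I * ((ξ * (α - 3) + 0 * (0 - 3) : ℝ) : ℂ)) *
        ∏ j, (fun (j : Fin 3) (x : ℝ) => (if j = 2 then (g x : ℂ) else 1) * e x) j (p j) := by
    intro p
    have := phase_eq ξ 0 α 0 0 p
    rw [zero_mul, add_zero] at this
    rw [this, Finset.prod_mul_distrib]
    simp only [e, Pi.zero_apply, Fin.prod_univ_three]
    simp
    ring
  simp_rw [hfac]
  rw [integral_const_mul, norm_mul, mul_comm Complex.I, Complex.norm_exp_ofReal_mul_I, one_mul,
    prod_T3 (fun (j : Fin 3) (x : ℝ) => (if j = 2 then (g x : ℂ) else 1) * e x),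
    norm_prod, Fin.prod_univ_three]
  simp only [Fin.isValue, if_true]
  have hpj : ∫ x in I1, e x = pj ξ 0 0 := rfl
  have hz : ¬ ((0 : Fin 3) = 2) := by decide
  have hz1 : ¬ ((1 : Fin 3) = 2) := by decide
  simp only [hz, hz1, if_false, one_mul, hpj]
  rw [← pow_two]
  gcongr
  refine (norm_integral_le_integral_norm _).trans (le_of_eq ?_)
  apply integral_congr_ae
  filter_upwards with x
  rw [norm_mul, he, mul_one, Complex.norm_real, Real.norm_of_nonneg (hg0 _)]

lemma T_bound : ∃ C : ℝ, 0 < C ∧ ∀ η α r : ℝ, 0 < η → η ≤ 1 →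
    ∫⁻ p in T3, ENNReal.ofReal (1 / √((α - edisp p) ^ 2 + η ^ 2) * dw (15/16) η (p 2 - r)) ≤
      ENNReal.ofReal (C * η ^ (-(1/8):ℝ)) := by
  obtain ⟨C1, hC1, h1⟩ := res_le_Kr
  obtain ⟨C2, hC2, h2⟩ := dw_int (15/16) (by norm_num) (by norm_num)
  have hG1 : 0 < Real.Gamma (1 - 15/16) := Real.Gamma_pos_of_pos (by norm_num)
  refine ⟨C1 * (65 * C2) * (2 * Real.Gamma (1 - 15/16)), by positivity, ?_⟩
  intro η α r hη hη1
  have hm := dw_meas (15/16) η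
  have hnn : ∀ x, 0 ≤ dw (15/16) η (x - r) := fun x => dw_nonneg _ _ _ hη
  obtain ⟨hi, hK⟩ := T_kernel η α (η ^ (-(15/16):ℝ)) (fun x => dw (15/16) η (x - r)) (by fun_prop) hnn
    (fun x => dw_le _ _ _ (by norm_num) hη) hη
  have hI0 : 0 ≤ ∫ x in I1, dw (15/16) η (x - r) := integral_nonneg hnn
  have hJ : ∫⁻ ξ : ℝ, ENNReal.ofReal (wt (1/16) η ξ * (‖pj ξ 0 0‖ ^ 2 * ∫ x in I1, dw (15/16) η (x - r))) ≤
      ENNReal.ofReal (65 * C2) * ENNReal.ofReal (2 * Real.Gamma (1 - 15/16) * η ^ (-(1 - 15/16):ℝ)) := by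
    rw [← wt_lintegral _ _ (by norm_num) hη]
    rw [← lintegral_const_mul' _ _ ENNReal.ofReal_ne_top]
    apply lintegral_mono_ae
    filter_upwards [Measure.ae_ne volume (0:ℝ)] with ξ hξ
    rw [← ENNReal.ofReal_mul (by positivity)]
    apply ENNReal.ofReal_le_ofReal
    have hx : 0 < |ξ| := abs_pos.2 hξ
    have hp := pj_sq_le ξ 0 0
    rw [abs_zero, sub_zero, abs_abs] at hp
    have hp2 : ‖pj ξ 0 0‖ ^ 2 ≤ 65 * |ξ| ^ (-(7/8):ℝ) := by
      refine hp.trans ?_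
      rw [div_eq_mul_inv]
      gcongr
      rw [Real.rpow_neg hx.le]
      apply inv_anti₀ (by positivity)
      rcases le_total |ξ| 1 with h | h
      · have := Real.rpow_le_one hx.le h (by norm_num : (0:ℝ) ≤ 7/8)
        linarith
      · have := Real.rpow_le_rpow_of_exponent_le h (by norm_num : (7/8:ℝ) ≤ 1)
        rw [Real.rpow_one] at this
        linarith
    have w1 := wt_nonneg (1/16) η ξ
    have key : wt (1/16) η ξ * |ξ| ^ (-(7/8):ℝ) = wt (15/16) η ξ := by
      unfold wt
      rw [mul_right_comm, ← Real.rpow_add hx]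
      norm_num
    rw [← key]
    calc _ ≤ wt (1/16) η ξ * ((65 * |ξ| ^ (-(7/8):ℝ)) * C2) := by
          gcongr
          exact (h2 η r hη).2
      _ = _ := by ring
  calc _ ≤ ∫⁻ p in T3, ENNReal.ofReal ((C1 * η ^ (-(1/16):ℝ)) * (Kr η (α - edisp p) * dw (15/16) η (p 2 - r))) := by
        apply lintegral_mono; intro p
        apply ENNReal.ofReal_le_ofReal
        refine (mul_le_mul_of_nonneg_right (h1 η _ hη) (hnn _)).trans (le_of_eq ?_)
        ring
    _ = ENNReal.ofReal (C1 * η ^ (-(1/16):ℝ)) * ENNReal.ofReal (∫ p in T3, Kr η (α - edisp p) * dw (15/16) η (p 2 - r)) := by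
        rw [ofReal_integral_eq_lintegral_ofReal hi
          (ae_of_all _ fun p => mul_nonneg (Kr_pos _ _ hη) (hnn _)),
          ← lintegral_const_mul' _ _ ENNReal.ofReal_ne_top]
        apply lintegral_congr; intro p
        rw [← ENNReal.ofReal_mul (by positivity)]
    _ ≤ ENNReal.ofReal (C1 * η ^ (-(1/16):ℝ)) * (ENNReal.ofReal (65 * C2) * ENNReal.ofReal (2 * Real.Gamma (1 - 15/16) * η ^ (-(1 - 15/16):ℝ))) := by
        gcongr
        exact hK.trans hJ
    _ = _ := by
        rw [← ENNReal.ofReal_mul (by positivity), ← ENNReal.ofReal_mul (by positivity)]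
        congr 1
        have : η ^ (-(1/8):ℝ) = η ^ (-(1/16):ℝ) * η ^ (-(1 - 15/16):ℝ) := by
          rw [← Real.rpow_add hη]; norm_num
        rw [this]; ring

lemma near1 : ∃ C : ℝ, 0 < C ∧ ∀ η u y : ℝ, 0 < η →
    ∫⁻ x in I1, ENNReal.ofReal (|Real.sin (2 * Real.pi * (x + y))| *
      (1 / √((u + Real.cos (2 * Real.pi * (x + y))) ^ 2 + η ^ 2))) ≤
      ENNReal.ofReal (C * η ^ (-(1/16):ℝ)) := by
  obtain ⟨C, hC, h⟩ := pow_sing (15/16) (by norm_num) (by norm_num)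
  refine ⟨4 * C, by positivity, ?_⟩
  intro η u y hη
  have hpi := Real.pi_gt_three
  let g : ℝ → ℝ := fun t => (η + |t - (-(u/2))|) ^ (-(15/16):ℝ)
  have hg0 : ∀ t, 0 ≤ g t := fun t => by simp only [g]; positivity
  have hgc : Continuous g := by
    simp only [g]
    apply Continuous.rpow_const (by fun_prop)
    intro x; left; positivity
  let f : ℝ → ℝ := fun x => Real.cos (2 * Real.pi * x) / 2
  have hfc : Continuous f := by simp only [f]; fun_prop
  let F : ℝ → ℝ := fun x => |Real.sin (2 * Real.pi * x)| * g (f x)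
  have hFc : Continuous F := by simp only [F]; fun_prop
  have hF0 : ∀ x, 0 ≤ F x := fun x => mul_nonneg (abs_nonneg _) (hg0 _)
  have hper : Function.Periodic F 1 := by
    intro x
    simp only [F, f]
    rw [show 2 * Real.pi * (x + 1) = 2 * Real.pi * x + 2 * Real.pi by ring, Real.cos_add_two_pi, Real.sin_add_two_pi]
  -- bound for g
  have hgi : ∫ t in (-(1/2):ℝ)..(1/2), g t ≤ C := by
    rw [intervalIntegral.integral_of_le (by norm_num), ← integral_Icc_eq_integral_Ioc,
      integral_eq_lintegral_of_nonneg_ae (ae_of_all _ hg0) hgc.aestronglyMeasurable]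
    exact ENNReal.toReal_le_of_le_ofReal hC.le (h η (-(u/2)) hη)
  have hsub : ∫ x in (0:ℝ)..(1/2), F x ≤ C := by
    have hd : ∀ x ∈ Set.uIcc (0:ℝ) (1/2), HasDerivAt f (-(Real.pi * Real.sin (2 * Real.pi * x))) x := by
      intro x _
      have h1 : HasDerivAt (fun x : ℝ => 2 * Real.pi * x) (2 * Real.pi) x := by
        simpa using (hasDerivAt_id x).const_mul (2 * Real.pi)
      exact (h1.cos.div_const 2).congr_deriv (by ring)
    have h2 := intervalIntegral.integral_comp_mul_deriv (g := g) hd (by fun_prop) hgc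
    have f0 : f 0 = 1/2 := by simp [f]
    have f1 : f (1/2) = -(1/2) := by
      simp only [f]; rw [show 2 * Real.pi * (1/2) = Real.pi by ring, Real.cos_pi]; norm_num
    rw [f0, f1, intervalIntegral.integral_symm (-(1/2)) (1/2)] at h2
    have h3 : ∫ x in (0:ℝ)..(1/2), F x * Real.pi = - ∫ x in (0:ℝ)..(1/2), (g ∘ f) x * -(Real.pi * Real.sin (2 * Real.pi * x)) := by
      rw [← intervalIntegral.integral_neg]
      apply intervalIntegral.integral_congr
      intro x hx
      rw [Set.uIcc_of_le (by norm_num)] at hx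
      have : 0 ≤ Real.sin (2 * Real.pi * x) :=
        Real.sin_nonneg_of_nonneg_of_le_pi (by have := hx.1; positivity) (by nlinarith [hx.2])
      simp only [F, Function.comp]
      rw [abs_of_nonneg this]; ring
    rw [h2, neg_neg, intervalIntegral.integral_mul_const] at h3
    have h4 : 0 ≤ ∫ x in (0:ℝ)..(1/2), F x :=
      intervalIntegral.integral_nonneg (by norm_num) (fun x _ => hF0 x)
    nlinarith
  have hall : ∫ x in I1, F (x + y) ≤ 2 * C := by
    rw [integral_Icc_eq_integral_Ioc, ← intervalIntegral.integral_of_le (by norm_num),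
      intervalIntegral.integral_comp_add_right]
    have := hper.intervalIntegral_add_eq (-(1/2) + y) (-(1/2))
    rw [show -(1/2) + y + 1 = 1/2 + y by ring, show (-(1/2):ℝ) + 1 = 1/2 by norm_num] at this
    rw [this]
    have e2 : ∫ x in (-(1/2):ℝ)..0, F x = ∫ x in (0:ℝ)..(1/2), F x := by
      have := intervalIntegral.integral_comp_neg (a := 0) (b := 1/2) F
      rw [neg_zero] at this
      rw [← this]
      congr 1; ext x
      simp only [F, f]
      rw [show 2 * Real.pi * (-x) = -(2 * Real.pi * x) by ring, Real.cos_neg, Real.sin_neg, abs_neg]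
    rw [← intervalIntegral.integral_add_adjacent_intervals (hFc.intervalIntegrable _ 0) (hFc.intervalIntegrable _ _), e2]
    linarith
  have hpt : ∀ x, |Real.sin (2 * Real.pi * (x + y))| *
      (1 / √((u + Real.cos (2 * Real.pi * (x + y))) ^ 2 + η ^ 2)) ≤ 2 * η ^ (-(1/16):ℝ) * F (x + y) := by
    intro x
    simp only [F, f, g]
    set c := Real.cos (2 * Real.pi * (x + y)) with hc
    set t := c / 2 - (-(u/2)) with ht
    have e : u + c = 2 * t := by rw [ht]; ring
    rw [e]
    have hm : 0 < η + |t| := by positivity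
    have h1 : 1 / √((2 * t) ^ 2 + η ^ 2) ≤ 2 * (η ^ (-(1/16):ℝ) * (η + |t|) ^ (-(15/16):ℝ)) := by
      have h2 : (η + |t|) / 2 ≤ √((2 * t) ^ 2 + η ^ 2) := by
        apply Real.le_sqrt_of_sq_le
        nlinarith [sq_abs t, sq_nonneg (η - |t|), sq_nonneg t, sq_nonneg η]
      calc _ ≤ 1 / ((η + |t|) / 2) := one_div_le_one_div_of_le (by positivity) h2
        _ = 2 * (1 / (η + |t|)) := by field_simp
        _ = 2 * ((η + |t|) ^ (-(1/16):ℝ) * (η + |t|) ^ (-(15/16):ℝ)) := by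
            rw [← Real.rpow_add hm]; norm_num [Real.rpow_neg_one]
        _ ≤ _ := by
            gcongr 2 * (?_ * _)
            exact Real.rpow_le_rpow_of_nonpos hη (by linarith [abs_nonneg t]) (by norm_num)
    calc _ ≤ |Real.sin (2 * Real.pi * (x + y))| * (2 * (η ^ (-(1/16):ℝ) * (η + |t|) ^ (-(15/16):ℝ))) := by gcongr
      _ = _ := by ring
  have hFi : IntegrableOn (fun x => F (x + y)) I1 :=
    ContinuousOn.integrableOn_Icc (by fun_prop)
  calc _ ≤ ∫⁻ x in I1, ENNReal.ofReal (2 * η ^ (-(1/16):ℝ)) * ENNReal.ofReal (F (x + y)) := by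
        apply lintegral_mono; intro x
        simp only
        rw [← ENNReal.ofReal_mul (by positivity)]
        exact ENNReal.ofReal_le_ofReal (hpt x)
    _ = ENNReal.ofReal (2 * η ^ (-(1/16):ℝ)) * ENNReal.ofReal (∫ x in I1, F (x + y)) := by
        rw [lintegral_const_mul' _ _ ENNReal.ofReal_ne_top, ofReal_integral_eq_lintegral_ofReal hFi (ae_of_all _ fun x => hF0 _)]
    _ ≤ ENNReal.ofReal (2 * η ^ (-(1/16):ℝ)) * ENNReal.ofReal (2 * C) := by gcongr
    _ = _ := by
        rw [← ENNReal.ofReal_mul (by positivity)]; congr 1; ring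

lemma dw2_lint : ∃ C : ℝ, 0 < C ∧ ∀ η : ℝ, ∀ r : Fin 2 → ℝ, 0 < η →
    ∫⁻ z : Fin 2 → ℝ, ENNReal.ofReal (∏ i, dw (7/8) η (z i - r i))
      ∂(Measure.pi fun _ => volume.restrict I1) ≤ ENNReal.ofReal C := by
  obtain ⟨C, hC, h⟩ := dw_int (7/8) (by norm_num) (by norm_num)
  refine ⟨C * C, by positivity, fun η r hη => ?_⟩
  rw [← ofReal_integral_eq_lintegral_ofReal]
  · apply ENNReal.ofReal_le_ofReal
    rw [integral_fintype_prod_eq_prod (fun i x => dw (7/8) η (x - r i)), Fin.prod_univ_two]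
    have : ∀ i, 0 ≤ ∫ x in I1, dw (7/8) η (x - r i) := fun i => integral_nonneg fun x => dw_nonneg _ _ _ hη
    exact mul_le_mul (h η _ hη).2 (h η _ hη).2 (this _) hC.le
  · exact Integrable.fintype_prod (f := fun i x => dw (7/8) η (x - r i)) (fun i => (h η (r i) hη).1)
  · exact ae_of_all _ fun z => Finset.prod_nonneg fun i _ => dw_nonneg _ _ _ hη

lemma lint_T3_succAbove (Φ : (Fin 3 → ℝ) → ENNReal) (hΦ : Measurable Φ) (j : Fin 3) :
    ∫⁻ p in T3, Φ p = ∫⁻ z : Fin 2 → ℝ, (∫⁻ x in I1, Φ (j.insertNth (α := fun _ => ℝ) x z))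
      ∂(Measure.pi fun _ => volume.restrict I1) := by
  have hmp := (measurePreserving_piFinSuccAbove (fun _ : Fin 3 => (volume : Measure ℝ).restrict I1) j).symm
  rw [T3_restrict, ← hmp.lintegral_comp hΦ, lintegral_prod_symm]
  · rfl
  · exact (hΦ.comp (MeasurableEquiv.measurable _)).aemeasurable

lemma near3 : ∃ C : ℝ, 0 < C ∧ ∀ η α : ℝ, ∀ y r : Fin 3 → ℝ, ∀ j : Fin 3, 0 < η →
    ∫⁻ p in T3, ENNReal.ofReal ((|Real.sin (2 * Real.pi * (p j + y j))| *
      (1 / √((α - edisp (p + y)) ^ 2 + η ^ 2))) *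
      ∏ i : Fin 2, dw (7/8) η (p (j.succAbove i) - r (j.succAbove i))) ≤
      ENNReal.ofReal (C * η ^ (-(1/16):ℝ)) := by
  obtain ⟨C1, hC1, h1⟩ := near1
  obtain ⟨C2, hC2, h2⟩ := dw2_lint
  refine ⟨C1 * C2, by positivity, ?_⟩
  intro η α y r j hη
  have hm := dw_meas (7/8) η
  have hec := edisp_cont
  rw [lint_T3_succAbove _ (by fun_prop) j]
  · calc _ ≤ ∫⁻ z : Fin 2 → ℝ, ENNReal.ofReal (C1 * η ^ (-(1/16):ℝ)) * ENNReal.ofReal (∏ i, dw (7/8) η (z i - r (j.succAbove i)))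
          ∂(Measure.pi fun _ => volume.restrict I1) := by
          apply lintegral_mono; intro z
          simp only
          have hprod : 0 ≤ ∏ i, dw (7/8) η (z i - r (j.succAbove i)) :=
            Finset.prod_nonneg fun i _ => dw_nonneg _ _ _ hη
          have := h1 η (α - 1 - ∑ i : Fin 2, (1 - Real.cos (2 * Real.pi * (z i + y (j.succAbove i))))) (y j) hη
          refine le_trans (le_of_eq ?_) (mul_le_mul_left this _)
          rw [← lintegral_mul_const' _ _ ENNReal.ofReal_ne_top]
          apply lintegral_congr; intro x
          rw [← ENNReal.ofReal_mul (by positivity)]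
          simp only [edisp,
            Fin.sum_univ_succAbove _ j, Pi.add_apply, Fin.insertNth_apply_same, Fin.insertNth_apply_succAbove]
          congr 6
          ring
      _ = ENNReal.ofReal (C1 * η ^ (-(1/16):ℝ)) * ∫⁻ z : Fin 2 → ℝ, ENNReal.ofReal (∏ i, dw (7/8) η (z i - r (j.succAbove i)))
          ∂(Measure.pi fun _ => volume.restrict I1) := by
          rw [lintegral_const_mul' _ _ ENNReal.ofReal_ne_top]
      _ ≤ ENNReal.ofReal (C1 * η ^ (-(1/16):ℝ)) * ENNReal.ofReal C2 := by
          gcongr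
          exact h2 η (fun i => r (j.succAbove i)) hη
      _ = _ := by
          rw [← ENNReal.ofReal_mul (by positivity)]; congr 1; ring

lemma four_dd_le (t : ℝ) : 4 * dd t ≤ |Real.sin (2 * Real.pi * t)| := by
  have hpi := Real.pi_pos
  have hq : dd t ≤ 1/4 := by
    have h1 := abs_le.1 (abs_sub_round t)
    set n := round t with hn
    have e1 : dd t ≤ |t - n| := by
      refine (min_le_left _ _).trans (le_of_eq ?_)
      unfold cdist; rw [sub_zero]
    have e2 : ∀ k : ℤ, dd t ≤ |t - 1/2 - k| := fun k =>
      (min_le_right _ _).trans (round_le (t - 1/2) k)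
    rcases le_total 0 (t - n) with h | h
    · have h2 := e2 n
      rw [abs_of_nonneg h] at e1
      rw [abs_of_nonpos (by linarith)] at h2
      linarith
    · have h2 := e2 (n - 1)
      push_cast at h2
      rw [abs_of_nonpos h] at e1
      rw [abs_of_nonneg (by linarith)] at h2
      linarith
  have key : ∀ u : ℝ, |u| ≤ 1/4 → 4 * |u| ≤ |Real.sin (2 * Real.pi * u)| := by
    intro u hu
    have h1 := @Real.mul_le_sin (2 * Real.pi * |u|) (by positivity) (by nlinarith)
    have h2 : 2 / Real.pi * (2 * Real.pi * |u|) = 4 * |u| := by field_simp; ring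
    rw [h2] at h1
    refine h1.trans ((le_abs_self _).trans (le_of_eq ?_))
    rcases abs_cases u with ⟨h, _⟩ | ⟨h, _⟩ <;> rw [h]
    rw [mul_neg, Real.sin_neg, abs_neg]
  unfold dd at hq ⊢
  rcases min_choice (cdist t 0) (cdist t (1/2)) with h | h
  · rw [h] at hq ⊢
    unfold cdist at hq ⊢
    refine (key _ hq).trans (le_of_eq ?_)
    rw [show 2 * Real.pi * (t - 0 - (round (t - 0) : ℝ)) = 2 * Real.pi * t - (round (t - 0) : ℤ) * (2 * Real.pi) by ring,
      Real.sin_sub_int_mul_two_pi]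
  · rw [h] at hq ⊢
    unfold cdist at hq ⊢
    refine (key _ hq).trans (le_of_eq ?_)
    rw [show 2 * Real.pi * (t - 1/2 - (round (t - 1/2) : ℝ)) = 2 * Real.pi * t - Real.pi - (round (t - 1/2) : ℤ) * (2 * Real.pi) by ring,
      Real.sin_sub_int_mul_two_pi, Real.sin_sub_pi, abs_neg]

lemma tnorm_eq (η : ℝ) (q : Fin 3 → ℝ) : tnorm η q = η + √(∑ j, dd (q j) ^ 2) := rfl

lemma tnorm_meas (η : ℝ) : Measurable (tnorm η) := by
  have := dd_meas
  have h : tnorm η = fun q => η + √(∑ j, dd (q j) ^ 2) := rfl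
  rw [h]; fun_prop

lemma tnorm_ge (η : ℝ) (q : Fin 3 → ℝ) (i : Fin 3) : η + dd (q i) ≤ tnorm η q := by
  rw [tnorm_eq]
  gcongr
  apply Real.le_sqrt_of_sq_le
  exact Finset.single_le_sum (f := fun j => dd (q j) ^ 2) (fun _ _ => sq_nonneg _) (Finset.mem_univ i)

lemma tnorm_le (η S : ℝ) (q : Fin 3 → ℝ) (hS : ∀ i, |Real.sin (2 * Real.pi * q i)| ≤ S) :
    tnorm η q ≤ η + S := by
  have hS0 : 0 ≤ S := (abs_nonneg _).trans (hS 0)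
  rw [tnorm_eq]
  gcongr
  apply Real.sqrt_le_iff.2 ⟨hS0, ?_⟩
  have : ∀ i, dd (q i) ^ 2 ≤ (S / 4) ^ 2 := fun i => by
    have h1 := dd_nonneg (q i)
    have h2 := (four_dd_le (q i)).trans (hS i)
    gcongr; linarith
  rw [Fin.sum_univ_three]
  have h0 := this 0
  have h1 := this 1
  have h2 := this 2
  nlinarith [sq_nonneg S]

lemma sin_tri (x y : ℝ) : |Real.sin (2 * Real.pi * y)| ≤
    |Real.sin (2 * Real.pi * x)| + |Real.sin (2 * Real.pi * (x + y))| := by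
  rw [show 2 * Real.pi * y = 2 * Real.pi * (x + y) - 2 * Real.pi * x by ring, Real.sin_sub]
  refine (abs_sub _ _).trans ?_
  rw [abs_mul, abs_mul, add_comm]
  gcongr
  · exact mul_le_of_le_one_left (abs_nonneg _) (Real.abs_cos_le_one _)
  · exact mul_le_of_le_one_right (abs_nonneg _) (Real.abs_cos_le_one _)

lemma norm_res (α e η : ℝ) : ‖(α : ℂ) - (e : ℂ) + (η : ℂ) * Complex.I‖ = √((α - e) ^ 2 + η ^ 2) := by
  rw [← Complex.ofReal_sub, Complex.norm_add_mul_I]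

lemma res_le (η t : ℝ) (hη : 0 < η) : 1 / √(t ^ 2 + η ^ 2) ≤ 1 / η :=
  one_div_le_one_div_of_le hη (Real.le_sqrt_of_sq_le (by nlinarith [sq_nonneg t]))

/-- weight bound by a single coordinate -/
lemma W_le_T (η : ℝ) (hη : 0 < η) (v : Fin 3 → ℝ) :
    1 / tnorm η v ≤ η ^ (-(1/16):ℝ) * dw (15/16) η (v 2) := by
  have h := tnorm_ge η v 2
  have h0 := dd_nonneg (v 2)
  have hm : 0 < η + dd (v 2) := by positivity
  calc _ ≤ 1 / (η + dd (v 2)) := one_div_le_one_div_of_le hm h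
    _ = (η + dd (v 2)) ^ (-(1/16):ℝ) * dw (15/16) η (v 2) := by
        unfold dw
        rw [← Real.rpow_add hm]; norm_num [Real.rpow_neg_one]
    _ ≤ _ := by
        have := dw_nonneg (15/16) η (v 2) hη
        gcongr ?_ * _
        exact Real.rpow_le_rpow_of_nonpos hη (by linarith) (by norm_num)

lemma W_le_near (η ρ : ℝ) (hη : 0 < η) (v : Fin 3 → ℝ) (j : Fin 3) (hv : tnorm η v < ρ) :
    1 / tnorm η v ≤ ρ ^ (3/4:ℝ) * ∏ i : Fin 2, dw (7/8) η (v (j.succAbove i)) := by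
  have hm : 0 < tnorm η v := by
    have := tnorm_ge η v 0
    have := dd_nonneg (v 0)
    linarith
  have hd : ∀ i, tnorm η v ^ (-(7/8):ℝ) ≤ dw (7/8) η (v i) := fun i => by
    have := dd_nonneg (v i)
    exact Real.rpow_le_rpow_of_nonpos (by positivity) (tnorm_ge η v i) (by norm_num)
  rw [Fin.prod_univ_two]
  calc 1 / tnorm η v = tnorm η v ^ (3/4:ℝ) * (tnorm η v ^ (-(7/8):ℝ) * tnorm η v ^ (-(7/8):ℝ)) := by
        rw [← Real.rpow_add hm, ← Real.rpow_add hm]; norm_num [Real.rpow_neg_one]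
    _ ≤ _ := by
        have h1 : tnorm η v ^ (3/4:ℝ) ≤ ρ ^ (3/4:ℝ) := Real.rpow_le_rpow hm.le hv.le (by norm_num)
        have hρ0 : 0 ≤ ρ ^ (3/4:ℝ) := Real.rpow_nonneg (hm.le.trans hv.le) _
        have h2 := hd (j.succAbove 0)
        have h3 := hd (j.succAbove 1)
        have := dw_nonneg (7/8) η (v (j.succAbove 0)) hη
        gcongr

lemma main_pt (η α β ρ : ℝ) (q r p : Fin 3 → ℝ) (j : Fin 3) (hη : 0 < η) (hρ : 0 < ρ)
    (hq : 0 < |Real.sin (2 * Real.pi * q j)|) :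
    1 / √((α - edisp p) ^ 2 + η ^ 2) * (1 / √((β - edisp (p + q)) ^ 2 + η ^ 2)) * (1 / tnorm η (p - r)) ≤
      1 / ρ * (1 / √((α - edisp p) ^ 2 + η ^ 2) * (1 / √((β - edisp (p + q)) ^ 2 + η ^ 2))) +
      (1 / η * ρ ^ (3/4:ℝ) * (1 / |Real.sin (2 * Real.pi * q j)|)) *
      ((|Real.sin (2 * Real.pi * p j)| * (1 / √((α - edisp p) ^ 2 + η ^ 2))) *
        ∏ i : Fin 2, dw (7/8) η (p (j.succAbove i) - r (j.succAbove i)) +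
       (|Real.sin (2 * Real.pi * (p j + q j))| * (1 / √((β - edisp (p + q)) ^ 2 + η ^ 2))) *
        ∏ i : Fin 2, dw (7/8) η (p (j.succAbove i) - r (j.succAbove i))) := by
  have ha := res_le η (α - edisp p) hη
  have hb := res_le η (β - edisp (p + q)) hη
  set a := 1 / √((α - edisp p) ^ 2 + η ^ 2) with hadef
  set b := 1 / √((β - edisp (p + q)) ^ 2 + η ^ 2) with hbdef
  have ha0 : 0 ≤ a := by positivity
  have hb0 : 0 ≤ b := by positivity
  set D := ∏ i : Fin 2, dw (7/8) η (p (j.succAbove i) - r (j.succAbove i)) with hD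
  have hD0 : 0 ≤ D := Finset.prod_nonneg fun i _ => dw_nonneg _ _ _ hη
  set S := |Real.sin (2 * Real.pi * q j)| with hS
  set s0 := |Real.sin (2 * Real.pi * p j)| with hs0
  set s1 := |Real.sin (2 * Real.pi * (p j + q j))| with hs1
  have h00 : 0 ≤ s0 := abs_nonneg _
  have h01 : 0 ≤ s1 := abs_nonneg _
  have htri : S ≤ s0 + s1 := sin_tri (p j) (q j)
  rcases le_or_gt ρ (tnorm η (p - r)) with h | h
  · have h1 : 1 / tnorm η (p - r) ≤ 1 / ρ := one_div_le_one_div_of_le hρ h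
    have h2 : a * b * (1 / tnorm η (p - r)) ≤ a * b * (1 / ρ) := by gcongr
    have h3 : 0 ≤ (1 / η * ρ ^ (3/4:ℝ) * (1 / S)) * (s0 * a * D + s1 * b * D) := by positivity
    linarith
  · have h1 : 1 / tnorm η (p - r) ≤ ρ ^ (3/4:ℝ) * D := W_le_near η ρ hη (p - r) j h
    have h2 : a * b ≤ (1 / η) * (1 / S) * (s0 * a + s1 * b) := by
      have e : a * b * S ≤ (1 / η) * (s0 * a + s1 * b) := by
        have e1 : a * b * S ≤ a * b * (s0 + s1) := by gcongr
        have e2 : s0 * a * b ≤ s0 * a * (1 / η) := by gcongr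
        have e3 : s1 * b * a ≤ s1 * b * (1 / η) := by gcongr
        linarith
      calc a * b = a * b * S * (1 / S) := by field_simp
        _ ≤ (1 / η) * (s0 * a + s1 * b) * (1 / S) := by gcongr
        _ = _ := by ring
    have h3 : 0 ≤ 1 / ρ * (a * b) := by positivity
    have h4 : a * b * (1 / tnorm η (p - r)) ≤ ((1 / η) * (1 / S) * (s0 * a + s1 * b)) * (ρ ^ (3/4:ℝ) * D) := by
      apply mul_le_mul h2 h1 _ (by positivity)
      have := tnorm_ge η (p - r) 0
      have := dd_nonneg ((p - r) 0)
      apply one_div_nonneg.2; linarith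
    calc _ ≤ _ := h4
      _ = (1 / η * ρ ^ (3/4:ℝ) * (1 / S)) * (s0 * a * D + s1 * b * D) := by ring
      _ ≤ _ := by linarith

/-- resolvent-type integrand -/
noncomputable def Fint (η α β : ℝ) (q r p : Fin 3 → ℝ) : ℝ :=
  1 / √((α - edisp p) ^ 2 + η ^ 2) * (1 / √((β - edisp (p + q)) ^ 2 + η ^ 2)) * (1 / tnorm η (p - r))

lemma case1 : ∃ C : ℝ, 0 < C ∧ ∀ η α β : ℝ, ∀ q r : Fin 3 → ℝ, 0 < η → η ≤ 1 →
    ∫⁻ p in T3, ENNReal.ofReal (Fint η α β q r p) ≤ ENNReal.ofReal (C * η ^ (-(19/16):ℝ)) := by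
  obtain ⟨C, hC, h⟩ := T_bound
  refine ⟨C, hC, fun η α β q r hη hη1 => ?_⟩
  calc _ ≤ ∫⁻ p in T3, ENNReal.ofReal (1 / η * η ^ (-(1/16):ℝ)) *
        ENNReal.ofReal (1 / √((α - edisp p) ^ 2 + η ^ 2) * dw (15/16) η (p 2 - r 2)) := by
        apply lintegral_mono; intro p
        simp only
        rw [← ENNReal.ofReal_mul (by positivity)]
        apply ENNReal.ofReal_le_ofReal
        unfold Fint
        have hb := res_le η (β - edisp (p + q)) hη
        have hW := W_le_T η hη (p - r)
        rw [Pi.sub_apply] at hW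
        have ht : 0 ≤ 1 / tnorm η (p - r) := by
          have := tnorm_ge η (p - r) 0
          have := dd_nonneg ((p - r) 0)
          apply one_div_nonneg.2; linarith
        calc _ ≤ 1 / √((α - edisp p) ^ 2 + η ^ 2) * (1 / η) * (η ^ (-(1/16):ℝ) * dw (15/16) η (p 2 - r 2)) := by
              gcongr
          _ = _ := by ring
    _ = ENNReal.ofReal (1 / η * η ^ (-(1/16):ℝ)) * ∫⁻ p in T3,
        ENNReal.ofReal (1 / √((α - edisp p) ^ 2 + η ^ 2) * dw (15/16) η (p 2 - r 2)) := by
        rw [lintegral_const_mul' _ _ ENNReal.ofReal_ne_top]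
    _ ≤ ENNReal.ofReal (1 / η * η ^ (-(1/16):ℝ)) * ENNReal.ofReal (C * η ^ (-(1/8):ℝ)) := by
        gcongr
        exact h η α (r 2) hη hη1
    _ = _ := by
        rw [← ENNReal.ofReal_mul (by positivity)]
        congr 1
        have : η ^ (-(19/16):ℝ) = 1 / η * η ^ (-(1/16):ℝ) * η ^ (-(1/8):ℝ) := by
          rw [one_div, ← Real.rpow_neg_one, ← Real.rpow_add hη, ← Real.rpow_add hη]; norm_num
        rw [this]; ring

lemma case2 : ∃ C : ℝ, 0 < C ∧ ∀ η α β : ℝ, ∀ q r : Fin 3 → ℝ, ∀ j : Fin 3, 0 < η → η ≤ 1 →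
    0 < |Real.sin (2 * Real.pi * q j)| →
    ∫⁻ p in T3, ENNReal.ofReal (Fint η α β q r p) ≤
      ENNReal.ofReal (C * η ^ (-(7/8):ℝ) / |Real.sin (2 * Real.pi * q j)|) := by
  obtain ⟨C1, hC1, h1⟩ := J_bound
  obtain ⟨C2, hC2, h2⟩ := near3
  refine ⟨C1 + 2 * C2, by positivity, fun η α β q r j hη hη1 hS => ?_⟩
  set S := |Real.sin (2 * Real.pi * q j)| with hSdef
  have hS1 : S ≤ 1 := Real.abs_sin_le_one _
  set ρ := η ^ (5/16:ℝ) with hρdef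
  have hρ : 0 < ρ := by positivity
  have hm := dw_meas (7/8) η
  have hec := edisp_cont
  have n0 := h2 η α 0 r j hη
  simp only [Pi.zero_apply, add_zero] at n0
  have n1 := h2 η β q r j hη
  have nJ := h1 η α β q j hη hη1 (abs_pos.1 hS)
  rw [← hSdef] at nJ
  set K := 1 / η * ρ ^ (3/4:ℝ) * (1 / S) with hK
  have hK0 : 0 ≤ K := by positivity
  have hprod : ∀ p : Fin 3 → ℝ, 0 ≤ ∏ i : Fin 2, dw (7/8) η (p (j.succAbove i) - r (j.succAbove i)) :=
    fun p => Finset.prod_nonneg fun i _ => dw_nonneg _ _ _ hη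
  calc _ ≤ ∫⁻ p in T3, (ENNReal.ofReal (1 / ρ) *
        ENNReal.ofReal (1 / √((α - edisp p) ^ 2 + η ^ 2) * (1 / √((β - edisp (p + q)) ^ 2 + η ^ 2))) +
        ENNReal.ofReal K * (
        ENNReal.ofReal ((|Real.sin (2 * Real.pi * p j)| * (1 / √((α - edisp p) ^ 2 + η ^ 2))) *
          ∏ i : Fin 2, dw (7/8) η (p (j.succAbove i) - r (j.succAbove i))) +
        ENNReal.ofReal ((|Real.sin (2 * Real.pi * (p j + q j))| * (1 / √((β - edisp (p + q)) ^ 2 + η ^ 2))) *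
          ∏ i : Fin 2, dw (7/8) η (p (j.succAbove i) - r (j.succAbove i))))) := by
        apply lintegral_mono; intro p
        simp only
        have := hprod p
        rw [← ENNReal.ofReal_add (by positivity) (by positivity), ← ENNReal.ofReal_mul (by positivity),
          ← ENNReal.ofReal_mul (by positivity), ← ENNReal.ofReal_add (by positivity) (by positivity)]
        apply ENNReal.ofReal_le_ofReal
        exact main_pt η α β ρ q r p j hη hρ hS
    _ = ENNReal.ofReal (1 / ρ) * (∫⁻ p in T3,
        ENNReal.ofReal (1 / √((α - edisp p) ^ 2 + η ^ 2) * (1 / √((β - edisp (p + q)) ^ 2 + η ^ 2)))) +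
        ENNReal.ofReal K * (
        (∫⁻ p in T3, ENNReal.ofReal ((|Real.sin (2 * Real.pi * p j)| * (1 / √((α - edisp p) ^ 2 + η ^ 2))) *
          ∏ i : Fin 2, dw (7/8) η (p (j.succAbove i) - r (j.succAbove i)))) +
        (∫⁻ p in T3, ENNReal.ofReal ((|Real.sin (2 * Real.pi * (p j + q j))| * (1 / √((β - edisp (p + q)) ^ 2 + η ^ 2))) *
          ∏ i : Fin 2, dw (7/8) η (p (j.succAbove i) - r (j.succAbove i))))) := by
        rw [lintegral_add_left (by fun_prop), lintegral_const_mul' _ _ ENNReal.ofReal_ne_top,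
          lintegral_const_mul' _ _ ENNReal.ofReal_ne_top, lintegral_add_left (by fun_prop)]
    _ ≤ ENNReal.ofReal (1 / ρ) * ENNReal.ofReal (C1 * η ^ (-(9/16):ℝ) * S ^ (-(1/2):ℝ)) +
        ENNReal.ofReal K * (ENNReal.ofReal (C2 * η ^ (-(1/16):ℝ)) + ENNReal.ofReal (C2 * η ^ (-(1/16):ℝ))) := by
        gcongr
    _ ≤ _ := by
        rw [← ENNReal.ofReal_add (by positivity) (by positivity), ← ENNReal.ofReal_mul (by positivity),
          ← ENNReal.ofReal_mul (by positivity), ← ENNReal.ofReal_add (by positivity) (by positivity)]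
        apply ENNReal.ofReal_le_ofReal
        have e1 : 1 / ρ * η ^ (-(9/16):ℝ) = η ^ (-(7/8):ℝ) := by
          rw [hρdef, one_div, ← Real.rpow_neg hη.le, ← Real.rpow_add hη]; norm_num
        have e2 : 1 / η * ρ ^ (3/4:ℝ) * η ^ (-(1/16):ℝ) ≤ η ^ (-(7/8):ℝ) := by
          rw [hρdef, one_div, ← Real.rpow_neg_one, ← Real.rpow_mul hη.le, ← Real.rpow_add hη, ← Real.rpow_add hη]
          exact Real.rpow_le_rpow_of_exponent_ge hη hη1 (by norm_num)
        have e3 : S ^ (-(1/2):ℝ) ≤ 1 / S := by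
          have e3' : 1 / S = S ^ (-1:ℝ) := by rw [Real.rpow_neg_one, one_div]
          rw [e3']
          exact Real.rpow_le_rpow_of_exponent_ge hS hS1 (by norm_num)
        calc _ = C1 * (1 / ρ * η ^ (-(9/16):ℝ)) * S ^ (-(1/2):ℝ) +
              2 * C2 * (1 / η * ρ ^ (3/4:ℝ) * η ^ (-(1/16):ℝ)) * (1 / S) := by rw [hK]; ring
          _ ≤ C1 * (η ^ (-(7/8):ℝ)) * (1 / S) + 2 * C2 * (η ^ (-(7/8):ℝ)) * (1 / S) := by
              rw [e1]; gcongr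
          _ = _ := by ring

/-- There is `c > 0` such that for all `0 < η ≤ 1/2`, all `α, β ∈ ℝ` and
all `q, r ∈ 𝕋³`:
`∫ dp / (|α - e(p) + iη| |β - e(p+q) + iη| |||p - r|||) ≤ c η^{-7/8} |log η|³ / |||q|||`. -/
theorem statement14 :
    ∃ c : ℝ, 0 < c ∧
      ∀ η : ℝ, 0 < η → η ≤ 1/2 →
        ∀ α β : ℝ, ∀ q r : Fin 3 → ℝ,
          (∫ p in T3,
              1 /
                (‖(α : ℂ) - (edisp p : ℂ) + (η : ℂ) * Complex.I‖ *
                  ‖(β : ℂ) - (edisp (p + q) : ℂ) + (η : ℂ) * Complex.I‖ *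
                  tnorm η (p - r))) ≤
            c * η ^ (-(7/8) : ℝ) * |Real.log η| ^ (3 : ℕ) / tnorm η q := by
  obtain ⟨C1, hC1, h1⟩ := case1
  obtain ⟨C2, hC2, h2⟩ := case2
  have hl2 : 0 < Real.log 2 := Real.log_pos (by norm_num)
  refine ⟨2 * (C1 + C2) / (Real.log 2) ^ 3, by positivity, ?_⟩
  intro η hη hη2 α β q r
  have hη1 : η ≤ 1 := by linarith
  have hlog : Real.log 2 ≤ |Real.log η| := by
    have : Real.log η ≤ Real.log (1/2) := Real.log_le_log hη hη2
    rw [one_div, Real.log_inv] at this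
    rw [abs_of_neg (by linarith)]; linarith
  have htq : 0 < tnorm η q := by
    have := tnorm_ge η q 0
    have := dd_nonneg (q 0)
    linarith
  have hF : ∀ p, 1 / (‖(α : ℂ) - (edisp p : ℂ) + (η : ℂ) * Complex.I‖ *
                  ‖(β : ℂ) - (edisp (p + q) : ℂ) + (η : ℂ) * Complex.I‖ *
                  tnorm η (p - r)) = Fint η α β q r p := by
    intro p
    rw [norm_res, norm_res, Fint, one_div_mul_one_div, one_div_mul_one_div]
  simp_rw [hF]
  have hF0 : ∀ p, 0 ≤ Fint η α β q r p := by
    intro p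
    have := tnorm_ge η (p - r) 0
    have := dd_nonneg ((p - r) 0)
    have : 0 < tnorm η (p - r) := by linarith
    unfold Fint; positivity
  have hFm : Measurable (Fint η α β q r) := by
    have := tnorm_meas η
    have hec := edisp_cont
    unfold Fint; fun_prop
  -- reduce to a bound without logarithm
  have hmain : ∫⁻ p in T3, ENNReal.ofReal (Fint η α β q r p) ≤
      ENNReal.ofReal (2 * (C1 + C2) * η ^ (-(7/8):ℝ) / tnorm η q) := by
    obtain ⟨j, hj⟩ := Finite.exists_max (fun i : Fin 3 => |Real.sin (2 * Real.pi * q i)|)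
    have ht := tnorm_le η _ q hj
    set S := |Real.sin (2 * Real.pi * q j)| with hS
    have hηρ : η ≤ η ^ (5/16:ℝ) := by
      nth_rewrite 1 [← Real.rpow_one η]
      exact Real.rpow_le_rpow_of_exponent_ge hη hη1 (by norm_num)
    rcases le_or_gt S (η ^ (5/16:ℝ)) with h | h
    · refine (h1 η α β q r hη hη1).trans (ENNReal.ofReal_le_ofReal ?_)
      rw [le_div_iff₀ htq]
      have e : η ^ (-(19/16):ℝ) * η ^ (5/16:ℝ) = η ^ (-(7/8):ℝ) := by
        rw [← Real.rpow_add hη]; norm_num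
      have hp : 0 ≤ η ^ (-(7/8):ℝ) := by positivity
      calc _ ≤ C1 * η ^ (-(19/16):ℝ) * (2 * η ^ (5/16:ℝ)) := by gcongr; linarith
        _ = 2 * C1 * η ^ (-(7/8):ℝ) := by rw [← e]; ring
        _ ≤ _ := by nlinarith
    · have hS0 : 0 < S := lt_trans (by positivity) h
      refine (h2 η α β q r j hη hη1 hS0).trans (ENNReal.ofReal_le_ofReal ?_)
      rw [← hS, div_le_div_iff₀ hS0 htq]
      have hp : 0 ≤ η ^ (-(7/8):ℝ) := by positivity
      calc _ ≤ C2 * η ^ (-(7/8):ℝ) * (2 * S) := by gcongr; linarith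
        _ ≤ 2 * (C1 + C2) * η ^ (-(7/8):ℝ) * S := by
            have : 0 ≤ C1 * η ^ (-(7/8):ℝ) * S := by positivity
            nlinarith
  rw [integral_eq_lintegral_of_nonneg_ae (ae_of_all _ hF0) hFm.aestronglyMeasurable]
  refine (ENNReal.toReal_le_of_le_ofReal (by positivity) hmain).trans ?_
  gcongr ?_ / _
  have h3 : (Real.log 2) ^ 3 ≤ |Real.log η| ^ 3 := by gcongr
  calc 2 * (C1 + C2) * η ^ (-(7/8):ℝ) = 2 * (C1 + C2) / (Real.log 2) ^ 3 * η ^ (-(7/8):ℝ) * (Real.log 2) ^ 3 := by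
        field_simp
    _ ≤ _ := by gcongr

end
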